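/- arXiv:2509.03663 — 6 statements merged into one kernel-verified Lean document; each statement's English description precedes it below -/
import Mathlib

section
/- Let A be a Hermitian algebra and let φ : A → ℂ be a continuous spectrally multiplicative function with φ(1) = 1. Then φ(x) = φ(Re(x)) + i·φ(Im(x)) for all x ∈ A, and φ is a character of A. -/
open scoped ComplexConjugate

/-- A character of a complex algebra: a nonzero linear multiplicative functional. -/
def IsCharacter {A : Type*} [Ring A] [Algebra ℂ A] (ψ : A → ℂ) : Prop :=
  ψ ≠ 0 ∧ IsLinearMap ℂ ψ ∧ ∀ x y : A, ψ (x * y) = ψ x * ψ y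

/-- φ is spectrally multiplicative if φ(x)·φ(y) ∈ σ(x·y) for all x, y. -/
def SpectrallyMultiplicative {A : Type*} [Ring A] [Algebra ℂ A] (φ : A → ℂ) : Prop :=
  ∀ x y : A, φ x * φ y ∈ spectrum ℂ (x * y)

/-- The Pták functional s(x) = √(ρ(x⋆x)). -/
noncomputable def ptak {A : Type*} [NormedRing A] [NormedAlgebra ℂ A] [StarRing A] (x : A) : ℝ :=
  Real.sqrt ((spectralRadius ℂ (star x * x)).toReal)

/-- The real part Re(x) = (x + x⋆)/2. -/
noncomputable def reP {A : Type*} [Ring A] [Algebra ℂ A] [StarRing A] (x : A) : A :=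
  (2 : ℂ)⁻¹ • (x + star x)

/-- The imaginary part Im(x) = (x - x⋆)/(2i). -/
noncomputable def imP {A : Type*} [Ring A] [Algebra ℂ A] [StarRing A] (x : A) : A :=
  ((2 : ℂ) * Complex.I)⁻¹ • (x - star x)

namespace SpectrallyMultiplicative

open Complex

section Algebraic

variable {A : Type*} [Ring A] [Algebra ℂ A] {φ : A → ℂ}

lemma apply_mem_spectrum (hsm : SpectrallyMultiplicative φ) (h1 : φ 1 = 1) (x : A) :
    φ x ∈ spectrum ℂ x := by
  simpa [h1] using hsm x 1

lemma nontrivial (hsm : SpectrallyMultiplicative φ) : Nontrivial A := by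
  by_contra h
  rw [not_nontrivial_iff_subsingleton] at h
  have := hsm 1 1
  rw [spectrum.of_subsingleton] at this
  exact this

lemma map_mul_map_inv (hsm : SpectrallyMultiplicative φ) {w v : A} (hwv : w * v = 1) :
    φ w * φ v = 1 := by
  have := hsm.nontrivial
  have h := hsm w v
  rwa [hwv, spectrum.one_eq, Set.mem_singleton_iff] at h

lemma not_isUnit_smul_sub_smul (hsm : SpectrallyMultiplicative φ) {w : A} (hw : IsUnit w)
    (z : A) : ¬ IsUnit (φ z • w - φ w • z) := by
  obtain ⟨u, rfl⟩ := hw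
  have huv : φ u * φ ↑u⁻¹ = 1 := hsm.map_mul_map_inv u.mul_inv
  have hφu : φ u ≠ 0 := left_ne_zero_of_mul_eq_one huv
  intro h
  apply spectrum.mem_iff.mp (hsm z ↑u⁻¹)
  have key : algebraMap ℂ A (φ z * φ ↑u⁻¹) - z * ↑u⁻¹
      = (φ u)⁻¹ • ((φ z • (u : A) - φ u • z) * ↑u⁻¹) := by
    rw [sub_mul, smul_mul_assoc, smul_mul_assoc, u.mul_inv, smul_sub, smul_smul, smul_smul,
      inv_mul_cancel₀ hφu, one_smul, Algebra.algebraMap_eq_smul_one,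
      eq_inv_of_mul_eq_one_right huv, mul_comm]
  rw [key]
  exact (h.mul u⁻¹.isUnit).smul (Units.mk0 _ (inv_ne_zero hφu))

/-- The imaginary part of `φ` along the slice `1 + i h`. -/
noncomputable def slice (φ : A → ℂ) (h : A) : ℝ := (φ (1 + I • h)).im

/-- A unital linear functional which is spectrally multiplicative preserves squares. -/
lemma map_mul_self (hsm : SpectrallyMultiplicative φ) (hlin : IsLinearMap ℂ φ) (h1 : φ 1 = 1)
    {x : A} {r : ℂ} (hr : r ≠ 0) (hp : IsUnit (r • (1 : A) + x)) (hm : IsUnit (r • (1 : A) - x)) :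
    φ (x * x) = φ x * φ x := by
  obtain ⟨p, hp⟩ := hp
  obtain ⟨m, hm⟩ := hm
  have hP := hsm.map_mul_map_inv p.mul_inv
  have hM := hsm.map_mul_map_inv m.mul_inv
  have hQ := hsm.map_mul_map_inv (m * p).mul_inv
  have hmp : (↑(m * p) : A) = (r * r) • (1 : A) - x * x := by
    rw [Units.val_mul, hp, hm]
    simp only [sub_mul, mul_add, smul_mul_assoc, mul_smul_comm, one_mul, mul_one]
    module
  have hsum : (2 * r) • (↑(m * p)⁻¹ : A) = ↑m⁻¹ + ↑p⁻¹ := by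
    have h2 : (2 * r) • (1 : A) = p + m := by
      rw [hp, hm, two_mul, add_smul]
      abel
    calc (2 * r) • (↑(m * p)⁻¹ : A) = ↑p⁻¹ * ((2 * r) • (1 : A)) * ↑m⁻¹ := by simp
      _ = _ := by rw [h2, mul_add, add_mul, p.inv_mul, one_mul, mul_assoc, m.mul_inv, mul_one]
  rw [hmp, hlin.map_sub, hlin.map_smul, h1, smul_eq_mul, mul_one] at hQ
  rw [hp, hlin.map_add, hlin.map_smul, h1, smul_eq_mul, mul_one] at hP
  rw [hm, hlin.map_sub, hlin.map_smul, h1, smul_eq_mul, mul_one] at hM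
  have hS := congrArg φ hsum
  rw [hlin.map_smul, hlin.map_add, smul_eq_mul] at hS
  refine mul_left_cancel₀ (mul_ne_zero two_ne_zero hr) ?_
  linear_combination (-2 * r * (r ^ 2 - φ x ^ 2)) * hQ
    + (r ^ 2 - φ (x * x)) * (r ^ 2 - φ x ^ 2) * hS
    + (r ^ 2 - φ (x * x)) * (r - φ x) * hP + (r ^ 2 - φ (x * x)) * (r + φ x) * hM

end Algebraic

/-- A linear functional on a ring which preserves squares is multiplicative. -/
lemma _root_.IsLinearMap.map_mul_of_map_mul_self {A : Type*} [Ring A] [Algebra ℂ A] {φ : A → ℂ}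
    (hlin : IsLinearMap ℂ φ) (h1 : φ 1 = 1) (hsq : ∀ x, φ (x * x) = φ x * φ x) (x y : A) :
    φ (x * y) = φ x * φ y := by
  have hjordan (x y : A) : φ (x * y) + φ (y * x) = 2 * φ x * φ y := by
    have h := hsq (x + y)
    simp only [mul_add, add_mul, hlin.map_add, hsq] at h
    linear_combination h
  have hker (x y : A) (hx : φ x = 0) : φ (x * y) = 0 := by
    have hadd : φ (x * y) + φ (y * x) = 0 := by rw [hjordan, hx]; ring
    have e : (x * y - y * x) * (x * y - y * x) + (x * y + y * x) * (x * y + y * x)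
        = (x * (y * x * y) + (y * x * y) * x) + (x * (y * x * y) + (y * x * y) * x) := by
      noncomm_ring
    have h := congrArg φ e
    rw [hlin.map_add, hlin.map_add, hsq, hsq, hlin.map_add, hlin.map_add,
      hadd, hlin.map_sub, hjordan x (y * x * y), hx] at h
    have h2 : φ (x * y) - φ (y * x) = 0 := by
      apply mul_self_eq_zero.mp
      linear_combination h
    linear_combination (hadd + h2) / 2
  have h := hker (x - φ x • 1) y (by rw [hlin.map_sub, hlin.map_smul, h1]; simp)
  rw [sub_mul, smul_mul_assoc, one_mul, hlin.map_sub, hlin.map_smul, smul_eq_mul] at h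
  linear_combination h

section Hermitian

variable {A : Type*} [NormedRing A] [NormedAlgebra ℂ A]

lemma continuous_slice {φ : A → ℂ} (hcont : Continuous φ) : Continuous (slice φ) :=
  continuous_im.comp (hcont.comp (by fun_prop))

variable [StarRing A] {φ : A → ℂ}

lemma _root_.IsSelfAdjoint.im_mul_conj_eq_zero
    (hHerm : ∀ a : A, star a = a → ∀ z ∈ spectrum ℂ a, z.im = 0) {h : A} (hh : star h = h)
    {α β : ℂ} (hu : ¬ IsUnit (α • (1 : A) + β • h)) : (α * conj β).im = 0 := by
  rcases eq_or_ne β 0 with rfl | hβ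
  · simp
  have hmem : -(α / β) ∈ spectrum ℂ h := by
    intro hc
    apply hu
    have e : α • (1 : A) + β • h = (-β) • (algebraMap ℂ A (-(α / β)) - h) := by
      rw [Algebra.algebraMap_eq_smul_one, smul_sub, smul_smul]
      have : -β * -(α / β) = α := by field_simp
      rw [this, neg_smul, sub_neg_eq_add]
    rw [e]
    exact IsUnit.smul (Units.mk0 (-β) (neg_ne_zero.mpr hβ)) hc
  have him := hHerm h hh _ hmem
  have e : α * conj β = ((-normSq β : ℝ) : ℂ) * (-(α / β)) := by
    push_cast
    rw [← mul_conj]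
    field_simp
  rw [e, im_ofReal_mul, him, mul_zero]

variable (hHerm : ∀ a : A, star a = a → ∀ z ∈ spectrum ℂ a, z.im = 0)
  (hcont : Continuous φ) (hsm : SpectrallyMultiplicative φ) (h1 : φ 1 = 1)

include hHerm in
lemma isUnit_one_add {h : A} (hh : star h = h) : IsUnit (1 + I • h) := by
  by_contra hc
  have := IsSelfAdjoint.im_mul_conj_eq_zero hHerm hh (α := 1) (β := I) (by rwa [one_smul])
  simp at this

include hHerm hsm h1 in
lemma apply_one_add {h : A} (hh : star h = h) : φ (1 + I • h) = 1 + I * slice φ h := by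
  have hmem := hsm.apply_mem_spectrum h1 (1 + I • h)
  rw [spectrum.mem_iff, Algebra.algebraMap_eq_smul_one] at hmem
  have e : φ (1 + I • h) • (1 : A) - (1 + I • h)
      = (φ (1 + I • h) - 1) • (1 : A) + (-I) • h := by
    rw [sub_smul, one_smul, neg_smul]; abel
  rw [e] at hmem
  have := IsSelfAdjoint.im_mul_conj_eq_zero hHerm hh hmem
  have hre : (φ (1 + I • h)).re = 1 := by
    simp at this
    linarith
  apply Complex.ext <;> simp [slice, hre]

variable [StarModule ℂ A]

lemma star_sub_smul_one {h : A} (hh : star h = h) (t : ℝ) :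
    star (h - (t : ℂ) • (1 : A)) = h - (t : ℂ) • (1 : A) := by
  simp [star_sub, star_smul, hh]

lemma star_ofReal_smul {h : A} (hh : star h = h) (t : ℝ) :
    star ((t : ℂ) • h) = (t : ℂ) • h := by
  simp [star_smul, hh]

include hHerm hsm

lemma unique_normalization {h : A} (hh : star h = h) {t t' : ℝ}
    (ht : φ (1 + I • (h - (t : ℂ) • (1 : A))) = 1)
    (ht' : φ (1 + I • (h - (t' : ℂ) • (1 : A))) = 1) : t = t' := by
  have := hsm.not_isUnit_smul_sub_smul (isUnit_one_add hHerm (star_sub_smul_one hh t))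
    (1 + I • (h - (t' : ℂ) • (1 : A)))
  rw [ht, ht'] at this
  by_contra hne
  apply this
  have e : (1 : ℂ) • (1 + I • (h - (t : ℂ) • (1 : A))) -
      (1 : ℂ) • (1 + I • (h - (t' : ℂ) • (1 : A))) = (I * (t' - t)) • (1 : A) := by
    module
  rw [e]
  have hne' : I * ((t' : ℂ) - t) ≠ 0 :=
    mul_ne_zero I_ne_zero (sub_ne_zero.mpr (by exact_mod_cast (Ne.symm hne)))
  exact IsUnit.smul (Units.mk0 _ hne') isUnit_one

include h1

lemma normalization_smul_aux {h : A} (hh : star h = h) {τ t : ℝ}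
    (ht : φ (1 + I • ((τ : ℂ) • h - (t : ℂ) • (1 : A))) = 1) :
    slice φ h = 0 ∨ t = τ * slice φ h := by
  have hk := apply_one_add hHerm hsm h1 hh
  set k := slice φ h
  have := hsm.not_isUnit_smul_sub_smul
    (isUnit_one_add hHerm (star_sub_smul_one (star_ofReal_smul hh τ) t)) (1 + I • h)
  rw [ht, hk] at this
  have e : (1 + I * (k : ℂ)) • (1 + I • ((τ : ℂ) • h - (t : ℂ) • (1 : A)))
      - (1 : ℂ) • (1 + I • h)
      = ((1 + I * k) * (1 - I * t) - 1 : ℂ) • (1 : A) + ((1 + I * k) * (I * τ) - I : ℂ) • h := by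
    module
  rw [e] at this
  have him := IsSelfAdjoint.im_mul_conj_eq_zero hHerm hh this
  simp at him
  have : k * (t - τ * k) = 0 := by linear_combination him
  rcases mul_eq_zero.mp this with h0 | h0
  · exact Or.inl h0
  · exact Or.inr (by linarith)

lemma normalization_smul {h : A} (hh : star h = h) {τ t : ℝ}
    (ht : φ (1 + I • ((τ : ℂ) • h - (t : ℂ) • (1 : A))) = 1) : t = τ * slice φ h := by
  rcases normalization_smul_aux hHerm hsm h1 hh ht with h0 | h0
  swap
  · exact h0
  rw [h0, mul_zero]
  have hφ : φ (1 + I • h) = 1 := by rw [apply_one_add hHerm hsm h1 hh, h0]; simp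
  have hτh := star_ofReal_smul hh τ
  have hφτ : φ (1 + I • ((τ : ℂ) • h)) = 1 := by
    rw [apply_one_add hHerm hsm h1 hτh]
    rcases eq_or_ne τ 0 with rfl | hτ
    · simp [slice, h1]
    have hτ' : (τ : ℂ) ≠ 0 := by exact_mod_cast hτ
    have := normalization_smul_aux hHerm hsm h1 hτh (τ := τ⁻¹) (t := 0)
      (by
        rw [smul_smul, ofReal_inv, inv_mul_cancel₀ hτ', one_smul, ofReal_zero, zero_smul, sub_zero]
        exact hφ)
    have hs : slice φ ((τ : ℂ) • h) = 0 := by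
      rcases this with h | h
      · exact h
      · simpa [hτ] using h.symm
    rw [hs, ofReal_zero, mul_zero, add_zero]
  exact unique_normalization hHerm hsm hτh ht (by simpa using hφτ)

include hcont
variable [CompleteSpace A]

lemma exists_normalization {h : A} (hh : star h = h) :
    ∃ t : ℝ, φ (1 + I • (h - (t : ℂ) • (1 : A))) = 1 := by
  have hF : Continuous fun t : ℝ => slice φ (h - (t : ℂ) • (1 : A)) :=
    (continuous_slice hcont).comp (by fun_prop)
  set R := ‖h‖ * ‖(1 : A)‖
  have hbound (t : ℝ) : |slice φ (h - (t : ℂ) • (1 : A)) + t| ≤ R := by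
    have hφ := apply_one_add hHerm hsm h1 (star_sub_smul_one hh t)
    have hmem := hsm.apply_mem_spectrum h1 (1 + I • (h - (t : ℂ) • (1 : A)))
    set k := slice φ (h - (t : ℂ) • (1 : A))
    rw [hφ, spectrum.mem_iff, Algebra.algebraMap_eq_smul_one] at hmem
    have hmem' : ((k + t : ℝ) : ℂ) ∈ spectrum ℂ h := by
      intro hc
      apply hmem
      have e : (1 + I * (k : ℂ)) • (1 : A) - (1 + I • (h - (t : ℂ) • (1 : A)))
          = I • (algebraMap ℂ A ((k + t : ℝ) : ℂ) - h) := by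
        rw [Algebra.algebraMap_eq_smul_one]
        push_cast
        module
      rw [e]
      exact IsUnit.smul (Units.mk0 I I_ne_zero) hc
    have := spectrum.subset_closedBall_norm_mul h hmem'
    rwa [mem_closedBall_zero_iff, norm_real, Real.norm_eq_abs] at this
  have hR : 0 ≤ R := by positivity
  have hzero : (0 : ℝ) ∈ Set.Icc (slice φ (h - (R : ℂ) • (1 : A)))
      (slice φ (h - ((-R : ℝ) : ℂ) • (1 : A))) := by
    have h2 := abs_le.mp (hbound R)
    have h3 := abs_le.mp (hbound (-R))
    constructor <;> linarith
  obtain ⟨t, -, ht⟩ := intermediate_value_Icc' (by linarith : -R ≤ R) hF.continuousOn hzero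
  refine ⟨t, ?_⟩
  rw [apply_one_add hHerm hsm h1 (star_sub_smul_one hh t)]
  simp only at ht
  rw [ht, ofReal_zero, mul_zero, add_zero]

lemma slice_smul {h : A} (hh : star h = h) (τ : ℝ) :
    slice φ ((τ : ℂ) • h) = τ * slice φ h := by
  obtain ⟨t, ht⟩ := exists_normalization hHerm hcont hsm h1 (star_ofReal_smul hh τ)
  rw [← normalization_smul hHerm hsm h1 hh ht]
  have := normalization_smul hHerm hsm h1 (star_ofReal_smul hh τ) (τ := 1) (t := t)
    (by simpa using ht)
  linarith

lemma apply_normalization {h : A} (hh : star h = h) :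
    φ (1 + I • (h - (slice φ h : ℂ) • (1 : A))) = 1 := by
  obtain ⟨t, ht⟩ := exists_normalization hHerm hcont hsm h1 hh
  have := normalization_smul hHerm hsm h1 hh (τ := 1) (t := t) (by simpa using ht)
  rw [one_mul] at this
  rwa [← this]

lemma slice_add_smul_one {h : A} (hh : star h = h) (r : ℝ) :
    slice φ (h + (r : ℂ) • (1 : A)) = slice φ h + r := by
  have hhr : star (h + (r : ℂ) • (1 : A)) = h + (r : ℂ) • (1 : A) := by
    simp [star_smul, hh]
  refine unique_normalization hHerm hsm hhr (apply_normalization hHerm hcont hsm h1 hhr) ?_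
  have e : h + (r : ℂ) • (1 : A) - ((slice φ h + r : ℝ) : ℂ) • (1 : A)
      = h - (slice φ h : ℂ) • (1 : A) := by
    push_cast
    module
  rw [e]
  exact apply_normalization hHerm hcont hsm h1 hh

lemma slice_add_smul_of_apply_ne_zero {h l : A} (hh : star h = h) (hl : star l = l)
    {c : ℂ} (hc : c ≠ 0)
    (hx : φ (c • (h + I • l)) = c) (M : ℝ) : slice φ (l + (M : ℂ) • h) = M := by
  have hm : star (l + (M : ℂ) • h) = l + (M : ℂ) • h := by simp [star_smul, hh, hl]
  have hφ := apply_normalization hHerm hcont hsm h1 hm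
  set s := slice φ (l + (M : ℂ) • h)
  have := hsm.not_isUnit_smul_sub_smul (isUnit_one_add hHerm (star_sub_smul_one hm s))
    (c • (h + I • l))
  rw [hφ, hx, one_smul] at this
  have hnu : ¬ IsUnit ((1 - I * s : ℂ) • (1 : A) + (I * M - 1 : ℂ) • h) := by
    intro hu
    apply this
    have e : c • (1 + I • (l + (M : ℂ) • h - (s : ℂ) • (1 : A))) - c • (h + I • l)
        = c • ((1 - I * s : ℂ) • (1 : A) + (I * M - 1 : ℂ) • h) := by
      module
    rw [e]
    exact IsUnit.smul (Units.mk0 _ hc) hu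
  have him := IsSelfAdjoint.im_mul_conj_eq_zero hHerm hh hnu
  simp at him
  linarith

lemma slice_smul_add_smul_of_apply_ne_zero {h l : A} (hh : star h = h) (hl : star l = l)
    {c : ℂ} (hc : c ≠ 0) (hx : φ (c • (h + I • l)) = c) (a b : ℝ) :
    slice φ ((a : ℂ) • l + (b : ℂ) • h) = b := by
  have hF : Continuous fun t : ℝ => slice φ ((t : ℂ) • l + (b : ℂ) • h) :=
    (continuous_slice hcont).comp (by fun_prop)
  refine congrFun (hF.ext_on (g := fun _ => b) (dense_compl_singleton 0) continuous_const ?_) a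
  intro t ht
  have ht0 : t ≠ 0 := ht
  have ht' : (t : ℂ) ≠ 0 := by exact_mod_cast ht0
  have e : (t : ℂ) • l + (b : ℂ) • h = (t : ℂ) • (l + ((b / t : ℝ) : ℂ) • h) := by
    rw [smul_add, smul_smul, ofReal_div, mul_div_cancel₀ _ ht']
  have hm : star (l + ((b / t : ℝ) : ℂ) • h) = l + ((b / t : ℝ) : ℂ) • h := by
    rw [star_add, star_ofReal_smul hh, hl]
  simp only
  rw [e, slice_smul hHerm hcont hsm h1 hm,
    slice_add_smul_of_apply_ne_zero hHerm hcont hsm h1 hh hl hc hx]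
  field_simp

end Hermitian

section RealImaginaryParts

variable {A : Type*} [Ring A] [Algebra ℂ A] [StarRing A]

/-- The complexification of the restriction of `slice φ` to the self-adjoint elements. -/
noncomputable def sliceExtension (φ : A → ℂ) (x : A) : ℂ :=
  slice φ (reP x) + I * slice φ (imP x)

lemma _root_.reP_add_I_smul_imP (x : A) : reP x + I • imP x = x := by
  have : I * (2 * I)⁻¹ = (2 : ℂ)⁻¹ := by field_simp
  rw [reP, imP, smul_smul, this]
  module

variable [StarModule ℂ A]

lemma _root_.star_reP (x : A) : star (reP x) = reP x := by
  simp [reP, star_smul, add_comm]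

lemma _root_.star_imP (x : A) : star (imP x) = imP x := by
  simp only [imP, star_smul, star_sub, star_star, star_def, map_inv₀, map_mul, conj_I, map_ofNat]
  rw [← neg_sub x, mul_neg, inv_neg, neg_smul_neg]

lemma _root_.reP_eq {g l : A} (hg : star g = g) (hl : star l = l) : reP (g + I • l) = g := by
  simp only [reP, star_add, star_smul, hg, hl, star_def, conj_I]
  module

lemma _root_.imP_eq {g l : A} (hg : star g = g) (hl : star l = l) : imP (g + I • l) = l := by
  simp only [imP, star_add, star_smul, hg, hl, star_def, conj_I]
  have e : g + I • l - (g + -I • l) = (2 * I) • l := by module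
  rw [e, smul_smul, inv_mul_cancel₀ (by simp), one_smul]

end RealImaginaryParts

section Linearity

variable {A : Type*} [NormedRing A] [NormedAlgebra ℂ A] [CompleteSpace A]

lemma _root_.isUnit_smul_one_add_of_lt {x : A} {r : ℂ} (hr : ‖x‖ * ‖(1 : A)‖ < ‖r‖) :
    IsUnit (r • (1 : A) + x) := by
  have h : r ∈ resolventSet ℂ (-x) := spectrum.mem_resolventSet_of_norm_lt_mul (by simpa using hr)
  rw [spectrum.mem_resolventSet_iff, Algebra.algebraMap_eq_smul_one, sub_neg_eq_add] at h
  exact h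

variable {φ : A → ℂ} (hcont : Continuous φ) (hsm : SpectrallyMultiplicative φ) (h1 : φ 1 = 1)

include hsm in
lemma apply_ne_zero_of_lt {x : A} {r : ℂ} (hr : ‖x‖ * ‖(1 : A)‖ < ‖r‖) :
    φ (r • (1 : A) + x) ≠ 0 := by
  obtain ⟨u, hu⟩ := isUnit_smul_one_add_of_lt hr
  rw [← hu]
  exact left_ne_zero_of_mul_eq_one (hsm.map_mul_map_inv u.mul_inv)

variable [StarRing A] [StarModule ℂ A]
  (hHerm : ∀ a : A, star a = a → ∀ z ∈ spectrum ℂ a, z.im = 0)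

include hcont hsm h1 hHerm

lemma slice_parts_of_apply_ne_zero {x : A} (hc : φ x ≠ 0) :
    slice φ (reP x) = (φ x).re ∧ slice φ (imP x) = (φ x).im ∧
      slice φ (reP x + imP x) = (φ x).re + (φ x).im := by
  set c := φ x with hcx
  set h := reP (c⁻¹ • x)
  set l := imP (c⁻¹ • x)
  have hh : star h = h := star_reP _
  have hl : star l = l := star_imP _
  have hx : x = c • (h + I • l) := by rw [reP_add_I_smul_imP, smul_inv_smul₀ hc]
  have key := slice_smul_add_smul_of_apply_ne_zero hHerm hcont hsm h1 hh hl hc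
    (by rw [← hx])
  have hx' : x = (((-c.im : ℝ) : ℂ) • l + (c.re : ℂ) • h)
      + I • ((c.re : ℂ) • l + (c.im : ℂ) • h) := by
    conv_lhs => rw [hx, ← re_add_im c]
    have hI : ((c.im : ℂ) * I * I) = -c.im := by rw [mul_assoc, I_mul_I]; ring
    rw [smul_add, smul_smul, add_mul, hI]
    push_cast
    module
  have hsa (a b : ℝ) : star ((a : ℂ) • l + (b : ℂ) • h) = (a : ℂ) • l + (b : ℂ) • h := by
    rw [star_add, star_ofReal_smul hh, star_ofReal_smul hl]
  have hre : reP x = ((-c.im : ℝ) : ℂ) • l + (c.re : ℂ) • h := by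
    conv_lhs => rw [hx']
    exact reP_eq (hsa _ _) (hsa _ _)
  have him : imP x = (c.re : ℂ) • l + (c.im : ℂ) • h := by
    conv_lhs => rw [hx']
    exact imP_eq (hsa _ _) (hsa _ _)
  refine ⟨by rw [hre, key], by rw [him, key], ?_⟩
  rw [hre, him, ← key (-c.im + c.re) (c.re + c.im)]
  congr 1
  push_cast
  module

lemma slice_add {g l : A} (hg : star g = g) (hl : star l = l) :
    slice φ (g + l) = slice φ g + slice φ l := by
  set r : ℝ := ‖g + I • l‖ * ‖(1 : A)‖ + 1
  have hr : ‖g + I • l‖ * ‖(1 : A)‖ < ‖(r : ℂ)‖ := by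
    rw [norm_real, Real.norm_eq_abs]
    exact (lt_add_one _).trans_le (le_abs_self _)
  have hgr : star (g + (r : ℂ) • (1 : A)) = g + (r : ℂ) • (1 : A) := by
    rw [star_add, star_ofReal_smul (star_one A), hg]
  have hgl : star (g + l) = g + l := by rw [star_add, hg, hl]
  have hne := hsm.apply_ne_zero_of_lt hr
  have e : (r : ℂ) • (1 : A) + (g + I • l) = g + (r : ℂ) • (1 : A) + I • l := by abel
  rw [e] at hne
  obtain ⟨hre, him, hadd⟩ := slice_parts_of_apply_ne_zero hcont hsm h1 hHerm hne
  rw [reP_eq hgr hl] at hre hadd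
  rw [imP_eq hgr hl] at him hadd
  rw [add_right_comm, slice_add_smul_one hHerm hcont hsm h1 hgl] at hadd
  rw [slice_add_smul_one hHerm hcont hsm h1 hg] at hre
  linarith

lemma isLinearMap_sliceExtension : IsLinearMap ℂ (sliceExtension φ) where
  map_add x y := by
    have hre : reP (x + y) = reP x + reP y := by simp only [reP, star_add]; module
    have him : imP (x + y) = imP x + imP y := by simp only [imP, star_add]; module
    simp only [sliceExtension, hre, him,
      slice_add hcont hsm h1 hHerm (star_reP x) (star_reP y),
      slice_add hcont hsm h1 hHerm (star_imP x) (star_imP y)]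
    push_cast
    ring
  map_smul c x := by
    have hx := reP_add_I_smul_imP x
    have hh := star_reP x
    have hl := star_imP x
    set h := reP x
    set l := imP x
    have hx' : c • x = ((c.re : ℂ) • h + ((-c.im : ℝ) : ℂ) • l)
        + I • ((c.im : ℂ) • h + (c.re : ℂ) • l) := by
      conv_lhs => rw [← hx, ← re_add_im c]
      have hI : ((c.im : ℂ) * I * I) = -c.im := by rw [mul_assoc, I_mul_I]; ring
      rw [smul_add, smul_smul, add_mul, hI]
      push_cast
      module
    have hsa (a b : ℝ) : star ((a : ℂ) • h + (b : ℂ) • l) = (a : ℂ) • h + (b : ℂ) • l := by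
      rw [star_add, star_ofReal_smul hh, star_ofReal_smul hl]
    have hslice (a b : ℝ) :
        slice φ ((a : ℂ) • h + (b : ℂ) • l) = a * slice φ h + b * slice φ l := by
      rw [slice_add hcont hsm h1 hHerm (star_ofReal_smul hh a) (star_ofReal_smul hl b),
        slice_smul hHerm hcont hsm h1 hh, slice_smul hHerm hcont hsm h1 hl]
    simp only [sliceExtension]
    rw [hx', reP_eq (hsa _ _) (hsa _ _), imP_eq (hsa _ _) (hsa _ _), hslice, hslice]
    change _ = c * (slice φ h + I * slice φ l)
    conv_rhs => rw [← re_add_im c]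
    push_cast
    linear_combination (-(c.im : ℂ) * slice φ l) * I_mul_I

lemma eq_sliceExtension_of_apply_ne_zero {x : A} (hc : φ x ≠ 0) : φ x = sliceExtension φ x := by
  obtain ⟨hre, him, -⟩ := slice_parts_of_apply_ne_zero hcont hsm h1 hHerm hc
  rw [sliceExtension, hre, him, mul_comm, re_add_im]

lemma sliceExtension_one : sliceExtension φ 1 = 1 := by
  rw [← eq_sliceExtension_of_apply_ne_zero hcont hsm h1 hHerm (by simp [h1]), h1]

lemma eq_sliceExtension : φ = sliceExtension φ := by
  have hlin := isLinearMap_sliceExtension hcont hsm h1 hHerm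
  funext x
  by_cases hφ : φ x = 0
  swap
  · exact eq_sliceExtension_of_apply_ne_zero hcont hsm h1 hHerm hφ
  by_contra hne
  set a := sliceExtension φ x with ha
  have ha0 : a ≠ 0 := fun h => hne (by rw [hφ, h])
  let f (t : ℝ) : ℂ := φ (((t : ℂ) * a) • (1 : A) + x)
  have hf (t : ℝ) : f t = 0 ∨ f t = (1 + t) * a := by
    by_cases h : f t = 0
    · exact Or.inl h
    right
    rw [show f t = _ from eq_sliceExtension_of_apply_ne_zero hcont hsm h1 hHerm h, hlin.map_add,
      hlin.map_smul, sliceExtension_one hcont hsm h1 hHerm, ← ha, smul_eq_mul]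
    ring
  let g (t : ℝ) : ℝ := (f t / ((1 + |t| : ℝ) * a)).re
  have hden (t : ℝ) : ((1 + |t| : ℝ) : ℂ) * a ≠ 0 :=
    mul_ne_zero (by exact_mod_cast (by positivity : (1 + |t| : ℝ) ≠ 0)) ha0
  have hg : Continuous g := by
    refine continuous_re.comp (Continuous.div ?_ (by fun_prop) hden)
    exact hcont.comp (by fun_prop)
  have hgval {t : ℝ} (ht : 0 ≤ t) (h : f t = (1 + t) * a) : g t = 1 := by
    have hd := hden t
    simp only [g, h]
    rw [abs_of_nonneg ht] at hd ⊢
    push_cast at hd ⊢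
    rw [div_self hd, one_re]
  set T : ℝ := (‖x‖ * ‖(1 : A)‖ + 1) / ‖a‖
  have hT : 0 ≤ T := by positivity
  have hfT : f T ≠ 0 := by
    apply hsm.apply_ne_zero_of_lt
    rw [norm_mul, norm_real, Real.norm_eq_abs, abs_of_nonneg hT,
      div_mul_cancel₀ _ (norm_ne_zero_iff.mpr ha0)]
    exact lt_add_one _
  have hgT : g T = 1 := hgval hT ((hf T).resolve_left hfT)
  have hg0 : g 0 = 0 := by simp [g, f, hφ]
  obtain ⟨t, ht, hgt⟩ := intermediate_value_Icc hT hg.continuousOn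
    (show (1 / 2 : ℝ) ∈ Set.Icc (g 0) (g T) by rw [hg0, hgT]; norm_num)
  rcases hf t with h | h
  · simp [g, h] at hgt
  · rw [hgval ht.1 h] at hgt
    norm_num at hgt

lemma isLinearMap : IsLinearMap ℂ φ := by
  rw [eq_sliceExtension hcont hsm h1 hHerm]
  exact isLinearMap_sliceExtension hcont hsm h1 hHerm

lemma isCharacter : IsCharacter φ := by
  have hlin := isLinearMap hcont hsm h1 hHerm
  refine ⟨fun h => by simp [h] at h1, hlin, hlin.map_mul_of_map_mul_self h1 fun x => ?_⟩
  set r : ℝ := ‖x‖ * ‖(1 : A)‖ + 1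
  have hr0 : 0 < r := by positivity
  have hr : ‖x‖ * ‖(1 : A)‖ < ‖(r : ℂ)‖ := by
    rw [norm_real, Real.norm_eq_abs]
    exact (lt_add_one _).trans_le (le_abs_self _)
  refine hsm.map_mul_self hlin h1 (r := r) (by exact_mod_cast hr0.ne')
    (isUnit_smul_one_add_of_lt hr) ?_
  rw [sub_eq_add_neg]
  exact isUnit_smul_one_add_of_lt (by rwa [norm_neg])

end Linearity

end SpectrallyMultiplicative

/-- Multiplicative Kowalski–Słodkowski theorem for Hermitian algebras (φ(1)=1 case). -/
theorem stmt_0 {A : Type*} [NormedRing A] [NormedAlgebra ℂ A] [CompleteSpace A]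
    [StarRing A] [StarModule ℂ A]
    (hHerm : ∀ a : A, star a = a → ∀ z ∈ spectrum ℂ a, z.im = 0)
    (φ : A → ℂ) (hcont : Continuous φ) (hsm : SpectrallyMultiplicative φ)
    (h1 : φ 1 = 1) :
    (∀ x : A, φ x = φ (reP x) + Complex.I * φ (imP x)) ∧ IsCharacter φ := by
  have hlin := SpectrallyMultiplicative.isLinearMap hcont hsm h1 hHerm
  refine ⟨fun x => ?_, SpectrallyMultiplicative.isCharacter hcont hsm h1 hHerm⟩
  conv_lhs => rw [← reP_add_I_smul_imP x]
  rw [hlin.map_add, hlin.map_smul, smul_eq_mul]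
end

section
/- Let A be a Hermitian algebra, and let (aₙ) and (bₙ) be sequences of self-adjoint elements of A such that for every n the element bₙ² − aₙ² is self-adjoint with spectrum contained in (0, ∞). If (vₙ) is a sequence in A such that s(bₙ·vₙ) → 0, then s(aₙ·vₙ) → 0, where s denotes the Pták functional. -/
open scoped ComplexConjugate

lemma norm_add_pow_le_of_commute {A : Type*} [NormedRing A] {x y : A} (hxy : Commute x y) {C D t : ℝ}
    (hx : ∀ n : ℕ, ‖x ^ n‖ ≤ C * t ^ n)
    (hy : ∀ n : ℕ, ‖y ^ n‖ ≤ D * t ^ n) (n : ℕ) :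
    ‖(x + y) ^ n‖ ≤ C * D * (2 * t) ^ n := by
  rw [hxy.add_pow]
  refine (norm_sum_le _ _).trans ?_
  have hsum : ∑ m ∈ Finset.range (n + 1), C * D * t ^ n * (n.choose m : ℝ) =
      C * D * (2 * t) ^ n := by
    rw [← Finset.mul_sum, ← Nat.cast_sum, Nat.sum_range_choose]
    push_cast
    ring
  rw [← hsum]
  refine Finset.sum_le_sum fun m hm => ?_
  have hmn : m + (n - m) = n := by have := Finset.mem_range.1 hm; omega
  rw [← nsmul_eq_mul']
  refine (norm_nsmul_le).trans ?_
  have h1 : ‖x ^ m * y ^ (n - m)‖ ≤ C * D * t ^ n := by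
    calc ‖x ^ m * y ^ (n - m)‖ ≤ ‖x ^ m‖ * ‖y ^ (n - m)‖ := norm_mul_le _ _
      _ ≤ (C * t ^ m) * (D * t ^ (n - m)) :=
        mul_le_mul (hx m) (hy _) (norm_nonneg _) ((norm_nonneg _).trans (hx m))
      _ = C * D * t ^ (m + (n - m)) := by rw [pow_add]; ring
      _ = C * D * t ^ n := by rw [hmn]
  rw [mul_comm]
  gcongr

section Spectrum

open Filter Topology Polynomial

variable {A : Type*} [NormedRing A] [NormedAlgebra ℂ A]

/-- Gelfand's formula as a geometric bound on the norms of powers. -/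
lemma exists_norm_pow_le_of_spectrum_le [CompleteSpace A] {x : A} {s t : ℝ} (hs : 0 ≤ s) (hst : s < t)
    (hx : ∀ z ∈ spectrum ℂ x, ‖z‖ ≤ s) : ∃ C : ℝ, 0 ≤ C ∧ ∀ n : ℕ, ‖x ^ n‖ ≤ C * t ^ n := by
  have ht : 0 < t := hs.trans_lt hst
  have hρ : spectralRadius ℂ x < ENNReal.ofReal t := by
    refine lt_of_le_of_lt (b := ENNReal.ofReal s) (iSup₂_le fun z hz => ?_)
      ((ENNReal.ofReal_lt_ofReal_iff ht).2 hst)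
    rw [← ENNReal.ofReal_coe_nnreal, coe_nnnorm]
    exact ENNReal.ofReal_le_ofReal (hx z hz)
  have hev : ∀ᶠ n : ℕ in atTop, ‖x ^ n‖ / t ^ n ≤ 1 := by
    filter_upwards [(spectrum.pow_norm_pow_one_div_tendsto_nhds_spectralRadius x).eventually_lt_const
      hρ, eventually_gt_atTop 0] with n hn hn0
    rw [ENNReal.ofReal_lt_ofReal_iff ht] at hn
    rw [div_le_one (by positivity)]
    calc ‖x ^ n‖ = (‖x ^ n‖ ^ (1 / n : ℝ)) ^ n := by
          rw [one_div, Real.rpow_inv_natCast_pow (norm_nonneg _) hn0.ne']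
      _ ≤ t ^ n := by gcongr
  obtain ⟨C, hC⟩ := (isBoundedUnder_of_eventually_le hev).bddAbove_range
  refine ⟨max C 0, le_max_right _ _, fun n => ?_⟩
  rw [← div_le_iff₀ (by positivity)]
  exact (hC ⟨n, rfl⟩).trans (le_max_left _ _)

lemma le_of_forall_pow_two_pow_le {a c K : ℝ} (hc : 0 < c)
    (h : ∀ n : ℕ, a ^ 2 ^ n ≤ K * c ^ 2 ^ n) : a ≤ c := by
  by_contra! hac
  have hq : 1 < a / c := (one_lt_div hc).2 hac
  obtain ⟨m, hm⟩ := pow_unbounded_of_one_lt K hq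
  have h1 : (a / c) ^ m ≤ (a / c) ^ 2 ^ m := pow_le_pow_right₀ hq.le Nat.lt_two_pow_self.le
  have h2 := h m
  rw [← div_le_iff₀ (by positivity), ← div_pow] at h2
  linarith

lemma norm_le_of_mem_spectrum_of_norm_pow_le [CompleteSpace A] {x : A} {C t : ℝ} (ht : 0 < t)
    (hx : ∀ n : ℕ, ‖x ^ n‖ ≤ C * t ^ n) {z : ℂ} (hz : z ∈ spectrum ℂ x) : ‖z‖ ≤ t := by
  refine le_of_forall_pow_two_pow_le (K := C * ‖(1 : A)‖) ht fun n => ?_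
  have h1 := spectrum.norm_le_norm_mul_of_mem (spectrum.pow_mem_pow x (2 ^ n) hz)
  rw [norm_pow] at h1
  nlinarith [hx (2 ^ n), norm_nonneg (1 : A)]

lemma inv_mul_mem_spectrum_of_mem_spectrum_smul {x : A} {c w : ℂ} (hc : c ≠ 0)
    (hw : w ∈ spectrum ℂ (c • x)) : c⁻¹ * w ∈ spectrum ℂ x := by
  have h : w = Units.mk0 c hc • (c⁻¹ * w) := by
    simp [Units.smul_def, hc]
  rw [h] at hw
  exact spectrum.smul_mem_smul_iff.1 hw

lemma norm_le_of_mem_spectrum_mul_comm {x y : A} {M : ℝ} (hM : 0 ≤ M)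
    (h : ∀ z ∈ spectrum ℂ (x * y), ‖z‖ ≤ M) : ∀ z ∈ spectrum ℂ (y * x), ‖z‖ ≤ M := by
  intro z hz
  rcases eq_or_ne z 0 with rfl | hz0
  · simpa using hM
  · have : z ∈ spectrum ℂ (y * x) \ {0} := ⟨hz, hz0⟩
    rw [spectrum.nonzero_mul_comm] at this
    exact h z this.1

lemma norm_aeval_le_of_norm_pow_le {u : A} {C t : ℝ} (hu : ∀ n : ℕ, ‖u ^ n‖ ≤ C * t ^ n)
    {P : ℝ[X]} (hP : ∀ i, 0 ≤ P.coeff i) : ‖aeval u P‖ ≤ C * P.eval t := by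
  rw [aeval_eq_sum_range, eval_eq_sum_range, Finset.mul_sum]
  refine (norm_sum_le _ _).trans (Finset.sum_le_sum fun i _ => ?_)
  rw [norm_smul, Real.norm_of_nonneg (hP i)]
  nlinarith [mul_le_mul_of_nonneg_left (hu i) (hP i)]

lemma Polynomial.coeff_mul_nonneg {P Q : ℝ[X]} (hP : ∀ i, 0 ≤ P.coeff i)
    (hQ : ∀ i, 0 ≤ Q.coeff i) (i : ℕ) : 0 ≤ (P * Q).coeff i := by
  rw [coeff_mul]
  exact Finset.sum_nonneg fun _ _ => mul_nonneg (hP _) (hQ _)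

/-- The approximations of `1 - √(1 - X)` given by `P ↦ (X + P ^ 2) / 2`. -/
noncomputable def oneSubSqrtApprox : ℕ → ℝ[X]
  | 0 => 0
  | k + 1 => C (1 / 2) * (X + oneSubSqrtApprox k ^ 2)

lemma coeff_oneSubSqrtApprox_nonneg (k i : ℕ) : 0 ≤ (oneSubSqrtApprox k).coeff i := by
  induction k generalizing i with
  | zero => simp [oneSubSqrtApprox]
  | succ k ih =>
    rw [oneSubSqrtApprox, coeff_C_mul, coeff_add, sq]
    have h1 := coeff_mul_nonneg ih ih i
    have h2 : (0 : ℝ) ≤ (X : ℝ[X]).coeff i := by rw [coeff_X]; split_ifs <;> norm_num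
    positivity

lemma coeff_oneSubSqrtApprox_succ_sub_nonneg (k i : ℕ) :
    0 ≤ (oneSubSqrtApprox (k + 1) - oneSubSqrtApprox k).coeff i := by
  induction k generalizing i with
  | zero =>
    have h := coeff_oneSubSqrtApprox_nonneg 1 i
    simpa [oneSubSqrtApprox] using h
  | succ k ih =>
    have h : oneSubSqrtApprox (k + 1 + 1) - oneSubSqrtApprox (k + 1) =
        C (1 / 2) * ((oneSubSqrtApprox (k + 1) - oneSubSqrtApprox k) *
          (oneSubSqrtApprox (k + 1) + oneSubSqrtApprox k)) := by
      rw [oneSubSqrtApprox]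
      conv_lhs => enter [2]; rw [oneSubSqrtApprox]
      ring
    rw [h, coeff_C_mul]
    refine mul_nonneg (by norm_num) (coeff_mul_nonneg ih (fun j => ?_) i)
    rw [coeff_add]
    exact add_nonneg (coeff_oneSubSqrtApprox_nonneg _ _) (coeff_oneSubSqrtApprox_nonneg _ _)

lemma eval_oneSubSqrtApprox_mem_Icc {t : ℝ} (h0 : 0 ≤ t) (h1 : t ≤ 1) (k : ℕ) :
    (oneSubSqrtApprox k).eval t ∈ Set.Icc 0 t := by
  induction k with
  | zero => simpa [oneSubSqrtApprox] using h0
  | succ k ih =>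
    obtain ⟨ih0, ih1⟩ := ih
    simp only [oneSubSqrtApprox, eval_mul, eval_C, eval_add, eval_X, eval_pow]
    constructor
    · positivity
    · nlinarith

lemma exists_one_sub_sqrt [CompleteSpace A] {u : A} {C t : ℝ} (hC : 0 ≤ C) (ht0 : 0 ≤ t) (ht1 : t < 1)
    (hu : ∀ n : ℕ, ‖u ^ n‖ ≤ C * t ^ n) :
    ∃ w : A, (2 : ℂ) • w = u + w ^ 2 ∧ (∀ n : ℕ, ‖w ^ n‖ ≤ C * t ^ n) ∧
      ∀ y : A, Commute y u → Commute y w := by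
  let W : ℕ → A := fun k => aeval u (oneSubSqrtApprox k)
  have hcauchy : CauchySeq W := by
    refine cauchySeq_of_dist_le_of_summable (fun k => C * ((oneSubSqrtApprox (k + 1)).eval t -
      (oneSubSqrtApprox k).eval t)) (fun k => ?_) (Summable.mul_left _ ?_)
    · rw [dist_comm, dist_eq_norm, ← eval_sub]
      simp only [W, ← map_sub]
      exact norm_aeval_le_of_norm_pow_le hu (coeff_oneSubSqrtApprox_succ_sub_nonneg k)
    · refine summable_of_sum_range_le (c := t) (fun k => ?_) fun n => ?_
      · rw [← eval_sub, eval_eq_sum_range]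
        exact Finset.sum_nonneg fun i _ =>
          mul_nonneg (coeff_oneSubSqrtApprox_succ_sub_nonneg k i) (by positivity)
      · rw [Finset.sum_range_sub (fun k => (oneSubSqrtApprox k).eval t)]
        have h1 := eval_oneSubSqrtApprox_mem_Icc ht0 ht1.le n
        have h2 := eval_oneSubSqrtApprox_mem_Icc ht0 ht1.le 0
        linarith [h1.2, h2.1]
  obtain ⟨w, hw⟩ := cauchySeq_tendsto_of_complete hcauchy
  have hrec (k : ℕ) : (2 : ℂ) • W (k + 1) = u + W k ^ 2 := by
    simp only [W, oneSubSqrtApprox, map_mul, map_add, map_pow, aeval_X, aeval_C]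
    rw [← Algebra.smul_def, ← Complex.coe_smul, smul_smul]
    norm_num
  refine ⟨w, ?_, fun n => ?_, fun y hy => ?_⟩
  · refine tendsto_nhds_unique (((tendsto_add_atTop_iff_nat 1).2 hw).const_smul (2 : ℂ)) ?_
    simp only [hrec]
    exact (hw.pow 2).const_add u
  · refine le_of_tendsto (hw.pow n).norm (Eventually.of_forall fun k => ?_)
    simp only [W, ← map_pow]
    have hco : ∀ m i, 0 ≤ (oneSubSqrtApprox k ^ m).coeff i := by
      intro m
      induction m with
      | zero => intro i; rw [pow_zero, coeff_one]; split_ifs <;> norm_num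
      | succ m ih => rw [pow_succ]; exact coeff_mul_nonneg ih (coeff_oneSubSqrtApprox_nonneg k)
    refine (norm_aeval_le_of_norm_pow_le hu (hco n)).trans ?_
    rw [eval_pow]
    have h1 := eval_oneSubSqrtApprox_mem_Icc ht0 ht1.le k
    gcongr
    · exact h1.1
    · exact h1.2
  · refine tendsto_nhds_unique (hw.const_mul y) ?_
    have h : ∀ k, y * W k = W k * y := fun k => by
      have : ∀ P : ℝ[X], Commute y (aeval u P) := fun P => by
        induction P using Polynomial.induction_on' with
        | add p q hp hq => rw [map_add]; exact hp.add_right hq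
        | monomial n a =>
          rw [aeval_monomial]
          exact Commute.mul_right (Algebra.commutes a y).symm (hy.pow_right n)
      exact this _
    simp only [h]
    exact hw.mul_const y

end Spectrum

section Hermitian

open Filter Topology

variable {A : Type*} [NormedRing A] [NormedAlgebra ℂ A] [CompleteSpace A]

omit [CompleteSpace A] in
lemma eq_of_two_smul_eq_add_sq {u w w' : A} {C C' t : ℝ} (ht0 : 0 ≤ t) (ht1 : t < 1)
    (hw : (2 : ℂ) • w = u + w ^ 2) (hw' : (2 : ℂ) • w' = u + w' ^ 2) (hcomm : Commute w w')
    (hwC : ∀ n : ℕ, ‖w ^ n‖ ≤ C * t ^ n) (hwC' : ∀ n : ℕ, ‖w' ^ n‖ ≤ C' * t ^ n) :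
    w = w' := by
  have hrec : (2 : ℂ) • (w - w') = (w + w') * (w - w') := by
    rw [smul_sub, hw, hw']
    linear_combination (norm := noncomm_ring) hcomm.eq
  have hpow (n : ℕ) : (2 : ℂ) ^ n • (w - w') = (w + w') ^ n * (w - w') := by
    induction n with
    | zero => simp
    | succ n ih => rw [pow_succ', mul_smul, ih, pow_succ, mul_assoc, ← hrec, mul_smul_comm]
  have hle (n : ℕ) : ‖w - w'‖ ≤ C * C' * ‖w - w'‖ * t ^ n := by
    have h1 : ‖(2 : ℂ) ^ n • (w - w')‖ = 2 ^ n * ‖w - w'‖ := by simp [norm_smul]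
    have h2 := norm_mul_le ((w + w') ^ n) (w - w')
    have h3 := norm_add_pow_le_of_commute hcomm hwC hwC' n
    rw [← hpow, h1] at h2
    have h4 := h2.trans (mul_le_mul_of_nonneg_right h3 (norm_nonneg _))
    rw [mul_pow] at h4
    have h5 : (0 : ℝ) < 2 ^ n := by positivity
    refine le_of_mul_le_mul_left ?_ h5
    linarith
  have hlim : Tendsto (fun n : ℕ => C * C' * ‖w - w'‖ * t ^ n) atTop (𝓝 0) := by
    simpa using (tendsto_pow_atTop_nhds_zero_of_lt_one ht0 ht1).const_mul (C * C' * ‖w - w'‖)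
  exact sub_eq_zero.1 (norm_le_zero_iff.1 (ge_of_tendsto' hlim hle))

variable [StarRing A] [StarModule ℂ A]

/-- Ford's square root lemma. -/
lemma exists_isSelfAdjoint_mul_self_eq_one_sub {u : A} (hu : star u = u) {s : ℝ} (hs0 : 0 ≤ s)
    (hs1 : s < 1) (hspec : ∀ z ∈ spectrum ℂ u, ‖z‖ ≤ s) :
    ∃ h : A, star h = h ∧ IsUnit h ∧ h * h = 1 - u := by
  obtain ⟨t, hst, ht1⟩ := exists_between hs1
  obtain ⟨r, htr, hr1⟩ := exists_between ht1
  have ht0 : 0 < t := hs0.trans_lt hst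
  obtain ⟨C, hC, huC⟩ := exists_norm_pow_le_of_spectrum_le hs0 hst hspec
  obtain ⟨w, hw, hwC, hwcomm⟩ := exists_one_sub_sqrt hC ht0.le ht1 huC
  have hwspec : ∀ z ∈ spectrum ℂ w, ‖z‖ ≤ t := fun z hz =>
    norm_le_of_mem_spectrum_of_norm_pow_le ht0 hwC hz
  obtain ⟨D, -, hwD⟩ := exists_norm_pow_le_of_spectrum_le ht0.le htr hwspec
  obtain ⟨D', -, hwD'⟩ := exists_norm_pow_le_of_spectrum_le (x := star w) ht0.le htr fun z hz => by
    rw [spectrum.map_star] at hz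
    simpa using hwspec _ hz
  have hw' : (2 : ℂ) • star w = u + star w ^ 2 := by
    have := congrArg star hw
    simpa [hu] using this
  have hcomm : Commute w (star w) := by
    have h1 : Commute (star w) (star u) := (hwcomm u (Commute.refl u)).symm.star_star
    rw [hu] at h1
    exact (hwcomm _ h1).symm
  have hstar : w = star w :=
    eq_of_two_smul_eq_add_sq (ht0.trans htr).le hr1 hw hw' hcomm hwD hwD'
  refine ⟨1 - w, by rw [star_sub, star_one, ← hstar], ?_, ?_⟩
  · have h1 : (1 : ℂ) ∉ spectrum ℂ w := fun h => by
      have := hwspec 1 h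
      rw [norm_one] at this
      linarith
    simpa using spectrum.notMem_iff.1 h1
  · rw [two_smul] at hw
    linear_combination (norm := noncomm_ring) -hw

omit [NormedAlgebra ℂ A] [CompleteSpace A] [StarModule ℂ A] in
lemma star_units_inv_of_star_eq {p : Aˣ} (hp : star (p : A) = p) :
    star (↑p⁻¹ : A) = ↑p⁻¹ := by
  have h : star p = p := Units.ext hp
  rw [← Units.coe_star, star_inv, h]

omit [CompleteSpace A] in
lemma isUnit_mul_self_add_of_star_eq_neg
    (hHerm : ∀ a : A, star a = a → ∀ z ∈ spectrum ℂ a, z.im = 0) {h k : A} (hh : star h = h)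
    (hu : IsUnit h) (hk : star k = -k) : IsUnit (h * h + k) := by
  obtain ⟨p, rfl⟩ := hu
  have hp := star_units_inv_of_star_eq hh
  set m : A := ↑p⁻¹ * k * ↑p⁻¹ with hm
  have hms : star (Complex.I • m) = Complex.I • m := by
    simp [hm, hp, hk, mul_assoc]
  have h1 : -Complex.I ∉ spectrum ℂ (Complex.I • m) := fun hmem => by
    simpa using hHerm _ hms _ hmem
  have h2 : (-1 : ℂ) ∉ spectrum ℂ m := fun hmem => h1 <| by
    have := (spectrum.smul_mem_smul_iff (r := Units.mk0 Complex.I Complex.I_ne_zero)).2 hmem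
    simpa [Units.smul_def] using this
  have h3 : IsUnit (1 + m) := by
    have := (spectrum.notMem_iff.1 h2).neg
    simpa [add_comm] using this
  have h4 : (p : A) * p + k = p * (1 + m) * p := by
    simp [hm, mul_add, add_mul, ← mul_assoc]
  rw [h4]
  exact (p.isUnit.mul h3).mul p.isUnit

lemma isUnit_one_sub_of_spectrum_star_mul_self_le
    (hHerm : ∀ a : A, star a = a → ∀ z ∈ spectrum ℂ a, z.im = 0) {x : A} {s : ℝ} (hs0 : 0 ≤ s)
    (hs1 : s < 1) (hx : ∀ z ∈ spectrum ℂ (star x * x), ‖z‖ ≤ s) : IsUnit (1 - x) := by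
  have hk : star (star x - x) = -(star x - x) := by simp
  obtain ⟨h, hh, hhu, hhx⟩ :=
    exists_isSelfAdjoint_mul_self_eq_one_sub (u := star x * x) (by simp) hs0 hs1 hx
  obtain ⟨g, hg, hgu, hgx⟩ :=
    exists_isSelfAdjoint_mul_self_eq_one_sub (u := x * star x) (by simp) hs0 hs1
      (norm_le_of_mem_spectrum_mul_comm hs0 hx)
  have hl := isUnit_mul_self_add_of_star_eq_neg hHerm hh hhu hk
  have hr := isUnit_mul_self_add_of_star_eq_neg hHerm hg hgu hk
  rw [hhx, show 1 - star x * x + (star x - x) = (1 + star x) * (1 - x) by noncomm_ring] at hl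
  rw [hgx, show 1 - x * star x + (star x - x) = (1 - x) * (1 + star x) by noncomm_ring] at hr
  obtain ⟨L, hL⟩ := hl.exists_left_inv
  obtain ⟨R, hR⟩ := hr.exists_right_inv
  exact isUnit_iff_exists_and_exists.2
    ⟨⟨_, (mul_assoc _ _ _).symm.trans hR⟩, ⟨_, (mul_assoc _ _ _).trans hL⟩⟩

/-- Pták's inequality `ρ(x)² ≤ ρ(x⋆x)`. -/
lemma norm_sq_le_of_spectrum_star_mul_self_le
    (hHerm : ∀ a : A, star a = a → ∀ z ∈ spectrum ℂ a, z.im = 0) {x : A} {M : ℝ} (hM : 0 ≤ M)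
    (hx : ∀ z ∈ spectrum ℂ (star x * x), ‖z‖ ≤ M) {z : ℂ} (hz : z ∈ spectrum ℂ x) :
    ‖z‖ ^ 2 ≤ M := by
  by_contra! hlt
  have hz0 : z ≠ 0 := by
    rintro rfl
    norm_num at hlt
    linarith
  have hpos : 0 < ‖z‖ ^ 2 := hM.trans_lt hlt
  have hy : star (z⁻¹ • x) * (z⁻¹ • x) = (star z⁻¹ * z⁻¹) • (star x * x) := by
    rw [star_smul, smul_mul_smul_comm]
  have hc : star z⁻¹ * z⁻¹ ≠ 0 := by simp [hz0]
  have hnorm : ‖star z⁻¹ * z⁻¹‖ = (‖z‖ ^ 2)⁻¹ := by simp [sq]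
  have hunit : IsUnit (1 - z⁻¹ • x) := by
    refine isUnit_one_sub_of_spectrum_star_mul_self_le hHerm (s := M / ‖z‖ ^ 2) (by positivity)
      ((div_lt_one hpos).2 hlt) fun w hw => ?_
    rw [hy] at hw
    have h1 := hx _ (inv_mul_mem_spectrum_of_mem_spectrum_smul hc hw)
    rw [norm_mul, norm_inv, hnorm, inv_inv] at h1
    rw [le_div_iff₀ hpos]
    linarith
  refine hz (spectrum.mem_resolventSet_iff.2 ?_)
  have h2 : algebraMap ℂ A z - x = algebraMap ℂ A z * (1 - z⁻¹ • x) := by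
    rw [← Algebra.smul_def, smul_sub, smul_smul, mul_inv_cancel₀ hz0, one_smul,
      Algebra.algebraMap_eq_smul_one]
  rw [h2]
  exact ((Ne.isUnit hz0).map (algebraMap ℂ A)).mul hunit

lemma norm_pow_two_pow_le_of_spectrum_pow_mul_pow_le
    (hHerm : ∀ a : A, star a = a → ∀ z ∈ spectrum ℂ a, z.im = 0) {h k : A} (hh : star h = h)
    (hk : star k = k) {z : ℂ} (hz : z ∈ spectrum ℂ (h * k)) (n : ℕ) {M : ℝ} (hM : 0 ≤ M)
    (hle : ∀ w ∈ spectrum ℂ (h ^ 2 ^ n * k ^ 2 ^ n), ‖w‖ ≤ M) : ‖z‖ ^ 2 ^ n ≤ M := by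
  induction n generalizing M with
  | zero => simpa using hle z (by simpa using hz)
  | succ n ih =>
    have h1 : ‖z‖ ^ 2 ^ n ≤ √M := by
      refine ih (Real.sqrt_nonneg _) fun w hw => Real.le_sqrt_of_sq_le ?_
      refine norm_sq_le_of_spectrum_star_mul_self_le hHerm hM ?_ hw
      rw [star_mul, star_pow, star_pow, hh, hk]
      have h2 : h ^ 2 ^ (n + 1) * k ^ 2 ^ (n + 1) =
          (h ^ 2 ^ n * h ^ 2 ^ n * k ^ 2 ^ n) * k ^ 2 ^ n := by
        rw [pow_succ 2 n, mul_two, pow_add, pow_add]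
        simp only [mul_assoc]
      rw [h2] at hle
      simpa only [mul_assoc] using norm_le_of_mem_spectrum_mul_comm hM hle
    rw [pow_succ, pow_mul]
    exact (Real.le_sqrt (by positivity) hM).1 h1

/-- The spectral radius is submultiplicative on products of two self-adjoint elements. -/
lemma norm_le_mul_of_mem_spectrum_mul
    (hHerm : ∀ a : A, star a = a → ∀ z ∈ spectrum ℂ a, z.im = 0) {h k : A} (hh : star h = h)
    (hk : star k = k) {s t : ℝ} (hs : 0 ≤ s) (ht : 0 ≤ t) (hhs : ∀ z ∈ spectrum ℂ h, ‖z‖ ≤ s)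
    (hkt : ∀ z ∈ spectrum ℂ k, ‖z‖ ≤ t) : ∀ z ∈ spectrum ℂ (h * k), ‖z‖ ≤ s * t := by
  intro z hz
  have hδ (δ : ℝ) (hδ : 0 < δ) : ‖z‖ ≤ (s + δ) * (t + δ) := by
    obtain ⟨C, hC, hhC⟩ := exists_norm_pow_le_of_spectrum_le hs (lt_add_of_pos_right s hδ) hhs
    obtain ⟨D, hD, hkD⟩ := exists_norm_pow_le_of_spectrum_le ht (lt_add_of_pos_right t hδ) hkt
    refine le_of_forall_pow_two_pow_le (K := C * D * ‖(1 : A)‖) (by positivity) fun n => ?_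
    refine norm_pow_two_pow_le_of_spectrum_pow_mul_pow_le hHerm hh hk hz n (by positivity)
      fun w hw => ?_
    calc ‖w‖ ≤ ‖h ^ 2 ^ n * k ^ 2 ^ n‖ * ‖(1 : A)‖ := spectrum.norm_le_norm_mul_of_mem hw
      _ ≤ (‖h ^ 2 ^ n‖ * ‖k ^ 2 ^ n‖) * ‖(1 : A)‖ := by gcongr; exact norm_mul_le _ _
      _ ≤ ((C * (s + δ) ^ 2 ^ n) * (D * (t + δ) ^ 2 ^ n)) * ‖(1 : A)‖ := by
        gcongr
        · exact hhC _
        · exact hkD _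
      _ = C * D * ‖(1 : A)‖ * ((s + δ) * (t + δ)) ^ 2 ^ n := by rw [mul_pow]; ring
  have hlim : Tendsto (fun δ : ℝ => (s + δ) * (t + δ)) (𝓝[>] 0) (𝓝 (s * t)) := by
    have : Continuous fun δ : ℝ => (s + δ) * (t + δ) := by fun_prop
    simpa using (this.tendsto 0).mono_left nhdsWithin_le_nhds
  exact ge_of_tendsto hlim (by filter_upwards [self_mem_nhdsWithin] with δ h using hδ δ h)

lemma exists_resolvent_contraction {h : A} (hh : star h = h)
    (hpos : spectrum ℂ h ⊆ Complex.ofReal '' Set.Ici 0) {r : ℝ} (hr : 0 < r) :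
    ∃ (p : Aˣ) (e : A) (s : ℝ), (p : A) = algebraMap ℂ A r + h ∧ star e = e ∧ 0 ≤ s ∧ s < 1 ∧
      (∀ z ∈ spectrum ℂ e, ‖z‖ ≤ s) ∧ (p : A) * e = h ∧ e * p = h := by
  have hunit : IsUnit (algebraMap ℂ A r + h) := by
    have h1 : (-r : ℂ) ∉ spectrum ℂ h := fun hmem => by
      obtain ⟨y, hy, hyr⟩ := hpos hmem
      have : y = -r := by exact_mod_cast hyr
      rw [Set.mem_Ici] at hy
      linarith
    have := (spectrum.notMem_iff.1 h1).neg
    rw [map_neg] at this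
    convert this using 1
    abel
  obtain ⟨p, hp⟩ := hunit
  have hps : star (p : A) = p := by
    rw [hp, star_add, hh, Algebra.algebraMap_eq_smul_one, star_smul, star_one]
    simp
  have hcomm : Commute (p : A) h := by
    rw [hp]
    exact (Algebra.commute_algebraMap_left _ _).add_left (Commute.refl h)
  have hcomm' : Commute (↑p⁻¹ : A) h := hcomm.units_inv_left
  have hpe : (p : A) * (↑p⁻¹ * h) = h := by simp
  set M := ‖h‖ * ‖(1 : A)‖ with hM
  have hM0 : 0 ≤ M := by positivity
  refine ⟨p, ↑p⁻¹ * h, M / (r + M), hp, ?_, by positivity, ?_, ?_, hpe, ?_⟩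
  · rw [star_mul, hh, star_units_inv_of_star_eq hps, hcomm'.eq]
  · rw [div_lt_one (by positivity)]
    linarith
  · intro z hz
    have key : (p : A) * (algebraMap ℂ A z - ↑p⁻¹ * h) =
        algebraMap ℂ A (z * r) - algebraMap ℂ A (1 - z) * h := by
      rw [mul_sub, hpe, hp, ← Algebra.commutes, mul_add, map_mul, map_sub, map_one]
      noncomm_ring
    have hnu : ¬ IsUnit (algebraMap ℂ A (z * r) - algebraMap ℂ A (1 - z) * h) := by
      rw [← key, Units.isUnit_units_mul]
      exact hz
    have hz1 : 1 - z ≠ 0 := fun h0 => hnu <| by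
      rw [h0, map_zero, zero_mul, sub_zero, (sub_eq_zero.1 h0).symm, one_mul]
      exact (Ne.isUnit (Complex.ofReal_ne_zero.2 hr.ne')).map _
    have hmem : z * r / (1 - z) ∈ spectrum ℂ h := fun hu => hnu <| by
      have := ((Ne.isUnit hz1).map (algebraMap ℂ A)).mul (spectrum.mem_resolventSet_iff.1 hu)
      rwa [mul_sub, ← map_mul, mul_div_cancel₀ _ hz1] at this
    obtain ⟨y, hy, hyz⟩ := hpos hmem
    rw [Set.mem_Ici] at hy
    have hyM : y ≤ M := by
      have := spectrum.norm_le_norm_mul_of_mem hmem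
      rwa [← hyz, Complex.norm_real, Real.norm_of_nonneg hy] at this
    have hry : ((r + y : ℝ) : ℂ) ≠ 0 := by
      rw [Complex.ofReal_ne_zero]
      positivity
    have hzy : z = ((y / (r + y) : ℝ) : ℂ) := by
      rw [eq_div_iff hz1] at hyz
      rw [Complex.ofReal_div, eq_div_iff hry]
      push_cast
      linear_combination -hyz
    rw [hzy, Complex.norm_real, Real.norm_of_nonneg (by positivity),
      div_le_div_iff₀ (by positivity) (by positivity)]
    nlinarith
  · rw [hcomm'.eq, mul_assoc]
    simp

lemma isUnit_algebraMap_add_add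
    (hHerm : ∀ a : A, star a = a → ∀ z ∈ spectrum ℂ a, z.im = 0) {h k : A} (hh : star h = h)
    (hk : star k = k) (hpos : spectrum ℂ h ⊆ Complex.ofReal '' Set.Ici 0)
    (kpos : spectrum ℂ k ⊆ Complex.ofReal '' Set.Ici 0) {r : ℝ} (hr : 0 < r) :
    IsUnit (algebraMap ℂ A r + h + k) := by
  obtain ⟨p, e, s, hp, he, hs0, hs1, hes, hpe, -⟩ := exists_resolvent_contraction hh hpos hr
  obtain ⟨q, f, t, hq, hf, ht0, ht1, hft, -, hfq⟩ := exists_resolvent_contraction hk kpos hr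
  have h1 : (1 : ℂ) ∉ spectrum ℂ (e * f) := fun hmem => by
    have := norm_le_mul_of_mem_spectrum_mul hHerm he hf hs0 ht0 hes hft 1 hmem
    rw [norm_one] at this
    nlinarith
  have h2 := spectrum.notMem_iff.1 h1
  rw [map_one] at h2
  have hr' : IsUnit (algebraMap ℂ A r) := (Ne.isUnit (Complex.ofReal_ne_zero.2 hr.ne')).map _
  have h3 : algebraMap ℂ A r * (algebraMap ℂ A r + h + k) = p * (1 - e * f) * q := by
    have h4 : (p : A) * (1 - e * f) * q = p * q - (p * e) * (f * q) := by noncomm_ring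
    rw [h4, hpe, hfq, hp, hq]
    have h5 := Algebra.commutes (r : ℂ) h
    linear_combination (norm := noncomm_ring) h5
  obtain ⟨R, hR⟩ := hr'
  rw [← hR] at h3 ⊢
  rw [← Units.isUnit_units_mul R, h3]
  exact (p.isUnit.mul h2).mul q.isUnit

/-- The sum of a nonnegative and a positive self-adjoint element is invertible. -/
lemma isUnit_add_of_spectrum_pos
    (hHerm : ∀ a : A, star a = a → ∀ z ∈ spectrum ℂ a, z.im = 0) {h d : A} (hh : star h = h)
    (hd : star d = d) (hpos : spectrum ℂ h ⊆ Complex.ofReal '' Set.Ici 0)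
    (dpos : spectrum ℂ d ⊆ Complex.ofReal '' Set.Ioi 0) : IsUnit (h + d) := by
  have h0 : (0 : ℂ) ∈ resolventSet ℂ d := by
    by_contra hmem
    obtain ⟨y, hy, hy0⟩ := dpos hmem
    rw [Set.mem_Ioi] at hy
    exact hy.ne' (by exact_mod_cast hy0)
  obtain ⟨ε, hε, hball⟩ := Metric.isOpen_iff.1 (spectrum.isOpen_resolventSet d) 0 h0
  have hk : star (d - algebraMap ℂ A ε) = d - algebraMap ℂ A ε := by
    rw [star_sub, hd, Algebra.algebraMap_eq_smul_one, star_smul, star_one]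
    simp
  have kpos : spectrum ℂ (d - algebraMap ℂ A ε) ⊆ Complex.ofReal '' Set.Ici 0 := by
    intro z hz
    have hzd : z + ε ∈ spectrum ℂ d := by
      rw [spectrum.add_mem_iff, neg_add_eq_sub]
      exact hz
    obtain ⟨y, hy, hyz⟩ := dpos hzd
    rw [Set.mem_Ioi] at hy
    refine ⟨y - ε, ?_, ?_⟩
    · by_contra! hlt
      refine hzd (hball ?_)
      rw [← hyz, mem_ball_zero_iff, Complex.norm_real, Real.norm_of_nonneg hy.le]
      simpa using hlt
    · push_cast
      linear_combination hyz
  have := isUnit_algebraMap_add_add hHerm hh hk hpos kpos hε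
  convert this using 1
  abel

lemma isUnit_smul_sq_add_of_spectrum_pos
    (hHerm : ∀ a : A, star a = a → ∀ z ∈ spectrum ℂ a, z.im = 0) {a d : A} (ha : star a = a)
    (hd : star d = d) (dpos : spectrum ℂ d ⊆ Complex.ofReal '' Set.Ioi 0) {c : ℝ} (hc : 0 ≤ c) :
    IsUnit ((c : ℂ) • a ^ 2 + d) := by
  have hs : star ((√c : ℂ) • a) = (√c : ℂ) • a := by simp [ha]
  have heq : (c : ℂ) • a ^ 2 = ((√c : ℂ) • a) ^ 2 := by
    rw [smul_pow, ← Complex.ofReal_pow, Real.sq_sqrt hc]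
  rw [heq]
  refine isUnit_add_of_spectrum_pos hHerm (by rw [star_pow, hs]) hd (fun z hz => ?_) dpos
  rw [spectrum.map_pow_of_pos _ two_pos] at hz
  obtain ⟨w, hw, rfl⟩ := hz
  have him := hHerm _ hs w hw
  exact ⟨w.re ^ 2, sq_nonneg w.re, by apply Complex.ext <;> simp [sq, him]⟩

lemma spectrum_star_mul_self_le_of_sq_sub_sq_pos
    (hHerm : ∀ a : A, star a = a → ∀ z ∈ spectrum ℂ a, z.im = 0) {a b : A} (ha : star a = a)
    (hb : star b = b) (hpos : spectrum ℂ (b ^ 2 - a ^ 2) ⊆ Complex.ofReal '' Set.Ioi 0) (v : A)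
    {M : ℝ} (hM : 0 ≤ M) (hbv : ∀ z ∈ spectrum ℂ (star (b * v) * (b * v)), ‖z‖ ≤ M) :
    ∀ z ∈ spectrum ℂ (star (a * v) * (a * v)), ‖z‖ ≤ M := by
  have hd : star (b ^ 2 - a ^ 2) = b ^ 2 - a ^ 2 := by simp [ha, hb]
  have hbu : IsUnit b := by
    have := isUnit_smul_sq_add_of_spectrum_pos hHerm ha hd hpos zero_le_one
    rw [Complex.ofReal_one, one_smul, add_sub_cancel] at this
    exact (isUnit_pow_iff two_ne_zero).1 this
  obtain ⟨p, rfl⟩ := hbu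
  have hp := star_units_inv_of_star_eq hb
  set g : A := ↑p⁻¹ * a ^ 2 * ↑p⁻¹ with hg
  have hgs : star g = g := by simp [hg, hp, ha, mul_assoc]
  have hconj (l : ℂ) : (p : A) * (algebraMap ℂ A l - g) * p = l • (p : A) ^ 2 - a ^ 2 := by
    have h1 : (p : A) * g * p = a ^ 2 := by simp [hg, mul_assoc]
    rw [mul_sub, sub_mul, h1, ← Algebra.commutes, mul_assoc, ← Algebra.smul_def, sq (p : A)]
  have hspec : ∀ z ∈ spectrum ℂ g, ‖z‖ ≤ 1 := by
    intro z hz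
    obtain ⟨l, rfl⟩ : ∃ l : ℝ, (l : ℂ) = z :=
      ⟨z.re, Complex.ext rfl (hHerm g hgs z hz).symm⟩
    have hnu : ¬ IsUnit ((l : ℂ) • (p : A) ^ 2 - a ^ 2) := by
      rw [← hconj, Units.isUnit_mul_units, Units.isUnit_units_mul]
      exact hz
    rw [Complex.norm_real, Real.norm_eq_abs, abs_le]
    constructor
    · by_contra! hl
      refine hnu ?_
      have h1 : 0 ≤ 1 + (-l)⁻¹ := by
        have : 0 < (-l)⁻¹ := inv_pos.2 (by linarith)
        linarith
      have hl0 : (l : ℂ) ≠ 0 := Complex.ofReal_ne_zero.2 (by linarith)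
      have h2 := isUnit_smul_sq_add_of_spectrum_pos hHerm ha hd hpos h1
      have h3 := ((Ne.isUnit hl0).map (algebraMap ℂ A)).mul h2
      rw [← Algebra.smul_def] at h3
      convert h3 using 1
      rw [smul_add, smul_smul, smul_sub]
      have h4 : (l : ℂ) * ((1 + (-l)⁻¹ : ℝ) : ℂ) = l - 1 := by
        push_cast
        field_simp
        ring
      rw [h4, sub_smul, one_smul]
      abel
    · by_contra! hl
      refine hnu ?_
      have h2 := isUnit_smul_sq_add_of_spectrum_pos hHerm hb hd hpos (sub_nonneg.2 hl.le)
      convert h2 using 1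
      rw [Complex.ofReal_sub, Complex.ofReal_one, sub_smul, one_smul]
      abel
  set y : A := p * v with hy
  have hprod : ∀ z ∈ spectrum ℂ (g * (y * star y)), ‖z‖ ≤ M := by
    have := norm_le_mul_of_mem_spectrum_mul hHerm hgs (k := y * star y) (by simp) zero_le_one hM
      hspec (norm_le_of_mem_spectrum_mul_comm hM hbv)
    simpa only [one_mul] using this
  have heq : star (a * v) * (a * v) = star y * (g * y) := by
    simp [hy, hg, hb, ha, sq, mul_assoc]
  rw [heq]
  refine norm_le_of_mem_spectrum_mul_comm hM ?_
  simpa only [mul_assoc] using hprod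

omit [StarRing A] [StarModule ℂ A] in
lemma spectralRadius_ne_top (x : A) : spectralRadius ℂ x ≠ ⊤ := by
  refine ne_top_of_le_ne_top (ENNReal.ofReal_ne_top (r := ‖x‖ * ‖(1 : A)‖))
    (iSup₂_le fun z hz => ?_)
  rw [← ENNReal.ofReal_coe_nnreal, coe_nnnorm]
  exact ENNReal.ofReal_le_ofReal (spectrum.norm_le_norm_mul_of_mem hz)

lemma ptak_mul_le_of_sq_sub_sq_pos
    (hHerm : ∀ a : A, star a = a → ∀ z ∈ spectrum ℂ a, z.im = 0) {a b : A} (ha : star a = a)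
    (hb : star b = b) (hpos : spectrum ℂ (b ^ 2 - a ^ 2) ⊆ Complex.ofReal '' Set.Ioi 0) (v : A) :
    ptak (a * v) ≤ ptak (b * v) := by
  refine Real.sqrt_le_sqrt (ENNReal.toReal_le_of_le_ofReal ENNReal.toReal_nonneg
    (iSup₂_le fun z hz => ?_))
  rw [← ENNReal.ofReal_coe_nnreal, coe_nnnorm]
  refine ENNReal.ofReal_le_ofReal (spectrum_star_mul_self_le_of_sq_sub_sq_pos hHerm ha hb hpos v
    ENNReal.toReal_nonneg (fun w hw => ?_) z hz)
  have h := ENNReal.toReal_mono (spectralRadius_ne_top _)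
    (le_iSup₂ (f := fun (k : ℂ) (_ : k ∈ spectrum ℂ (star (b * v) * (b * v))) =>
      (‖k‖₊ : ENNReal)) w hw)
  simpa using h

end Hermitian

theorem stmt_2 {A : Type*} [NormedRing A] [NormedAlgebra ℂ A] [CompleteSpace A]
    [StarRing A] [StarModule ℂ A]
    (hHerm : ∀ a : A, star a = a → ∀ z ∈ spectrum ℂ a, z.im = 0)
    (a b v : ℕ → A)
    (ha : ∀ n, star (a n) = a n) (hb : ∀ n, star (b n) = b n)
    (hsa : ∀ n, star (b n ^ 2 - a n ^ 2) = b n ^ 2 - a n ^ 2)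
    (hpos : ∀ n, spectrum ℂ (b n ^ 2 - a n ^ 2) ⊆ Complex.ofReal '' Set.Ioi 0)
    (hv : Filter.Tendsto (fun n => ptak (b n * v n)) Filter.atTop (nhds 0)) :
    Filter.Tendsto (fun n => ptak (a n * v n)) Filter.atTop (nhds 0) :=
  squeeze_zero (fun _ => Real.sqrt_nonneg _)
    (fun n => ptak_mul_le_of_sq_sub_sq_pos hHerm (ha n) (hb n) (hpos n) (v n)) hv
end

section
/- Let A be a Hermitian algebra, let a ∈ A be self-adjoint with σ(a) ⊆ [0, ∞), and for each n ≥ 1 let yₙ ∈ A be a self-adjoint element such that σ(yₙ) ⊆ (0, ∞) and yₙ² = a + (1/n²)·1. Then for each n the element 1 + i·n·yₙ is invertible in A, and s(yₙ·(1 + i·n·yₙ)⁻¹) → 0 as n → ∞, where s denotes the Pták functional. -/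
open scoped ComplexConjugate

/-- If every spectral value of `b` is nonnegative and `v * u = 1 + r b` with `u`, `v` invertible
and `r > 0`, then `v⁻¹ b u⁻¹` has spectral radius at most `r⁻¹`. -/
theorem spectrum_inv_mul_mul_inv_norm_le {A : Type*} [Ring A] [Algebra ℂ A] {b : A} {u v : Aˣ}
    {r : ℝ} (hr : 0 < r) (hb : spectrum ℂ b ⊆ Complex.ofReal '' Set.Ici 0)
    (huv : (v * u : A) = 1 + (r : ℂ) • b) {z : ℂ}
    (hz : z ∈ spectrum ℂ ((↑v⁻¹ : A) * b * (↑u⁻¹ : A))) : ‖z‖ ≤ r⁻¹ := by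
  have hr0 : (r : ℂ) ≠ 0 := by exact_mod_cast hr.ne'
  by_cases h1 : 1 - r * z = 0
  · have hz' : z = ((r⁻¹ : ℝ) : ℂ) := by
      push_cast
      field_simp
      linear_combination -h1
    rw [hz', Complex.norm_real, Real.norm_of_nonneg (by positivity)]
  · have hfac : algebraMap ℂ A z - (↑v⁻¹ : A) * b * (↑u⁻¹ : A) =
        ↑v⁻¹ * ((1 - r * z) • (algebraMap ℂ A (z / (1 - r * z)) - b)) * ↑u⁻¹ := by
      have hmid : (1 - r * z) • (algebraMap ℂ A (z / (1 - r * z)) - b) = z • (v * u : A) - b := by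
        rw [huv, smul_sub, Algebra.algebraMap_eq_smul_one, smul_smul, mul_div_cancel₀ _ h1]
        module
      rw [hmid, Algebra.algebraMap_eq_smul_one, mul_sub, sub_mul, mul_smul_comm, smul_mul_assoc]
      simp
    have hmem : z / (1 - r * z) ∈ spectrum ℂ b := by
      intro hunit
      refine hz ?_
      change IsUnit (algebraMap ℂ A z - (↑v⁻¹ : A) * b * (↑u⁻¹ : A))
      rw [hfac]
      exact ((v⁻¹).isUnit.mul (hunit.smul (Units.mk0 _ h1))).mul (u⁻¹).isUnit
    obtain ⟨t, ht, hte⟩ := hb hmem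
    have ht : 0 ≤ t := ht
    have hpos : 0 < 1 + r * t := by positivity
    have hpos' : (1 : ℂ) + r * t ≠ 0 := by exact_mod_cast hpos.ne'
    have hz' : z = ((t / (1 + r * t) : ℝ) : ℂ) := by
      rw [eq_div_iff h1] at hte
      push_cast
      rw [eq_div_iff hpos']
      linear_combination -hte
    rw [hz', Complex.norm_real, Real.norm_of_nonneg (by positivity), div_le_iff₀ hpos]
    field_simp
    linarith

/-- A scalar perturbation `1 + i c y` with `c` real is invertible if `y` has real spectrum. -/
theorem isUnit_one_add_I_smul {A : Type*} [Ring A] [Algebra ℂ A] {y : A}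
    (hy : ∀ z ∈ spectrum ℂ y, z.im = 0) (c : ℝ) : IsUnit (1 + (Complex.I * (c : ℂ)) • y) := by
  rcases eq_or_ne c 0 with rfl | hc
  · simp
  have hc' : Complex.I * (c : ℂ) ≠ 0 := by simp [hc]
  have hunit : IsUnit (algebraMap ℂ A (-(Complex.I * c)⁻¹) - y) := by
    by_contra h
    have := hy _ h
    simp [hc] at this
  convert hunit.smul (Units.mk0 _ (neg_ne_zero.mpr hc')) using 1
  rw [Units.smul_mk0, Algebra.algebraMap_eq_smul_one, smul_sub, smul_smul, neg_mul_neg,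
    mul_inv_cancel₀ hc', one_smul, neg_smul, sub_neg_eq_add]

/-- The Pták functional of `y (1 + i c y)⁻¹` is at most `c⁻¹`. -/
theorem ptak_mul_inverse_le {A : Type*} [NormedRing A] [NormedAlgebra ℂ A]
    [StarRing A] [StarModule ℂ A] {y : A} (hysa : star y = y)
    (hy : ∀ z ∈ spectrum ℂ y, z.im = 0) {c : ℝ} (hc : 0 < c) :
    ptak (y * Ring.inverse (1 + (Complex.I * (c : ℂ)) • y)) ≤ c⁻¹ := by
  obtain ⟨u, hu⟩ := isUnit_one_add_I_smul hy c
  have hv : ((star u : Aˣ) : A) = 1 - (Complex.I * (c : ℂ)) • y := by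
    rw [Units.coe_star, hu]
    simp [hysa, sub_eq_add_neg]
  have hmul : ((star u : Aˣ) : A) * u = 1 + ((c ^ 2 : ℝ) : ℂ) • (y ^ 2) := by
    rw [hv, hu, sub_mul, mul_add, mul_add, one_mul, one_mul, mul_one, smul_mul_smul_comm, ← pow_two,
      ← pow_two, mul_pow, Complex.I_sq]
    push_cast
    module
  have hsq : spectrum ℂ (y ^ 2) ⊆ Complex.ofReal '' Set.Ici 0 := by
    rw [spectrum.map_pow_of_pos y two_pos]
    rintro _ ⟨s, hs, rfl⟩
    refine ⟨s.re ^ 2, sq_nonneg s.re, ?_⟩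
    have hre : (s.re : ℂ) = s := Complex.ext rfl (hy s hs).symm
    simp [hre]
  have hstar : star (y * Ring.inverse (1 + (Complex.I * (c : ℂ)) • y)) *
      (y * Ring.inverse (1 + (Complex.I * (c : ℂ)) • y)) =
      ((star u)⁻¹ : Aˣ) * y ^ 2 * (u⁻¹ : Aˣ) := by
    rw [← hu, Ring.inverse_unit, star_mul, hysa, ← Units.coe_star, star_inv, pow_two]
    simp only [mul_assoc]
  have hrad : spectralRadius ℂ (star (y * Ring.inverse (1 + (Complex.I * (c : ℂ)) • y)) *
      (y * Ring.inverse (1 + (Complex.I * (c : ℂ)) • y))) ≤ ENNReal.ofReal (c ^ 2)⁻¹ := by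
    refine iSup₂_le fun z hz => ?_
    rw [hstar] at hz
    rw [← enorm_eq_nnnorm, ← ofReal_norm]
    exact ENNReal.ofReal_le_ofReal
      (spectrum_inv_mul_mul_inv_norm_le (by positivity) hsq hmul hz)
  refine Real.sqrt_le_iff.mpr ⟨by positivity, ?_⟩
  rw [inv_pow]
  exact ENNReal.toReal_le_of_le_ofReal (by positivity) hrad

theorem stmt_6 {A : Type*} [NormedRing A] [NormedAlgebra ℂ A] [CompleteSpace A]
    [StarRing A] [StarModule ℂ A]
    (hHerm : ∀ a : A, star a = a → ∀ z ∈ spectrum ℂ a, z.im = 0)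
    (a : A) (ha : star a = a)
    (haspec : spectrum ℂ a ⊆ Complex.ofReal '' Set.Ici 0)
    (y : ℕ → A)
    (hysa : ∀ n : ℕ, 1 ≤ n → star (y n) = y n)
    (hyspec : ∀ n : ℕ, 1 ≤ n → spectrum ℂ (y n) ⊆ Complex.ofReal '' Set.Ioi 0)
    (hysq : ∀ n : ℕ, 1 ≤ n → y n ^ 2 = a + (((n : ℂ) ^ 2)⁻¹) • 1) :
    (∀ n : ℕ, 1 ≤ n → IsUnit (1 + (Complex.I * (n : ℂ)) • y n)) ∧
      Filter.Tendsto
        (fun n : ℕ => ptak (y n * Ring.inverse (1 + (Complex.I * (n : ℂ)) • y n)))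
        Filter.atTop (nhds 0) := by
  have him : ∀ n : ℕ, 1 ≤ n → ∀ z ∈ spectrum ℂ (y n), z.im = 0 :=
    fun n hn => hHerm _ (hysa n hn)
  refine ⟨fun n hn => by simpa using isUnit_one_add_I_smul (him n hn) n, ?_⟩
  refine squeeze_zero' (.of_forall fun n => Real.sqrt_nonneg _) ?_
    (tendsto_inv_atTop_nhds_zero_nat (𝕜 := ℝ))
  filter_upwards [Filter.eventually_ge_atTop 1] with n hn
  simpa using ptak_mul_inverse_le (hysa n hn) (him n hn) (c := n) (by exact_mod_cast hn)
end

section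
/- Let A be a Hermitian algebra and let φ : A → ℂ be a continuous spectrally multiplicative function with φ(1) = 1. If x ∈ A satisfies φ(Re(x)) + i·φ(Im(x)) = 0, then φ(x) = 0. -/
open scoped ComplexConjugate

section Helpers

variable {A : Type*} [NormedRing A] [NormedAlgebra ℂ A] {φ : A → ℂ}

lemma SpectrallyMultiplicative.nontrivial_s7 (hsm : SpectrallyMultiplicative φ) : Nontrivial A := by
  by_contra h
  rw [not_nontrivial_iff_subsingleton] at h
  have := hsm 1 1
  rw [spectrum.of_subsingleton] at this
  exact this

lemma SpectrallyMultiplicative.mem_spectrum (hsm : SpectrallyMultiplicative φ) (h1 : φ 1 = 1)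
    (x : A) : φ x ∈ spectrum ℂ x := by
  simpa [h1] using hsm x 1

lemma SpectrallyMultiplicative.map_mul_map_inv_s7 (hsm : SpectrallyMultiplicative φ) (w : Aˣ) :
    φ w * φ ↑w⁻¹ = 1 := by
  have := hsm.nontrivial_s7
  simpa [spectrum.one_eq] using hsm w ↑w⁻¹

lemma SpectrallyMultiplicative.map_ne_zero (hsm : SpectrallyMultiplicative φ) {w : A}
    (hw : IsUnit w) : φ w ≠ 0 := by
  obtain ⟨w, rfl⟩ := hw
  exact left_ne_zero_of_mul_eq_one (hsm.map_mul_map_inv_s7 w)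

lemma SpectrallyMultiplicative.not_isUnit_sub (hsm : SpectrallyMultiplicative φ) (v : A) {w : A}
    (hw : IsUnit w) : ¬ IsUnit (φ v • w - φ w • v) := by
  intro h
  have h0 := hsm.map_ne_zero hw
  obtain ⟨w, rfl⟩ := hw
  have hm := hsm v ↑w⁻¹
  rw [spectrum.mem_iff] at hm
  apply hm
  have hinv : φ ↑w⁻¹ = (φ w)⁻¹ := (inv_eq_of_mul_eq_one_right (hsm.map_mul_map_inv_s7 w)).symm
  have hu : IsUnit ((φ w)⁻¹ • ((φ v • (w : A) - φ w • v) * ↑w⁻¹)) :=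
    (h.mul w⁻¹.isUnit).smul (Units.mk0 _ (inv_ne_zero h0))
  convert hu using 1
  rw [hinv, Algebra.algebraMap_eq_smul_one, sub_mul, smul_mul_assoc, smul_mul_assoc,
    Units.mul_inv, smul_sub, smul_smul, smul_smul, inv_mul_cancel₀ h0, one_smul, mul_comm]

/-- In a star algebra whose self-adjoint elements have real spectrum, a self-adjoint element
plus a non-real scalar is invertible. -/
lemma isUnit_smul_one_add [StarRing A]
    (hHerm : ∀ a : A, star a = a → ∀ z ∈ spectrum ℂ a, z.im = 0) {a : A} (ha : star a = a)
    {l : ℂ} (hl : l.im ≠ 0) : IsUnit (l • (1 : A) + a) := by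
  by_contra h
  have hmem : -l ∈ spectrum ℂ a := by
    rw [spectrum.mem_iff, Algebra.algebraMap_eq_smul_one]
    intro h'
    apply h
    convert h'.neg using 1
    module
  exact hl (by simpa using hHerm a ha _ hmem)

lemma exists_real_of_not_isUnit [StarRing A]
    (hHerm : ∀ a : A, star a = a → ∀ z ∈ spectrum ℂ a, z.im = 0) {a : A} (ha : star a = a)
    {p e : ℂ} (h : ¬ IsUnit (p • (1 : A) + e • a)) : ∃ τ : ℝ, p = τ * e := by
  by_cases he : e = 0
  · refine ⟨0, ?_⟩
    by_contra hp
    apply h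
    have hp' : p ≠ 0 := by simpa using hp
    simpa [he, Units.smul_def] using (isUnit_one (M := A)).smul (Units.mk0 p hp')
  · refine ⟨(p / e).re, ?_⟩
    have him : (p / e).im = 0 := by
      by_contra hne
      apply h
      convert (isUnit_smul_one_add hHerm ha hne).smul (Units.mk0 e he) using 1
      change _ = e • ((p / e) • (1 : A) + a)
      rw [smul_add, smul_smul, mul_div_cancel₀ _ he]
    have : ((p / e).re : ℂ) = p / e := Complex.ext (by simp) (by simp [him])
    rw [this, div_mul_cancel₀ _ he]

lemma eq_of_exists_real_proportional {t : ℂ → ℝ}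
    (ht : ∀ l m : ℂ, l.im ≠ 0 → m.im ≠ 0 →
      ∃ τ : ℝ, (t l : ℂ) * m - t m * l = τ * (l + t l - m - t m))
    {l m : ℂ} (hl : l.im ≠ 0) (hm : m.im ≠ 0) : t l = t m := by
  have line : ∀ l m : ℂ, l.im ≠ 0 → l.im = m.im → t l = t m := by
    intro l m hl hlm
    obtain ⟨τ, hτ⟩ := ht l m hl (hlm ▸ hl)
    have him := congrArg Complex.im hτ
    simp [← hlm] at him
    have : (t l - t m) * l.im = 0 := by linarith
    rcases mul_eq_zero.1 this with h | h
    · linarith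
    · exact absurd h hl
  by_cases hlm : l.im = m.im
  · exact line l m hl hlm
  have key : ∀ s s' : ℝ, ∃ τ : ℝ, t l * m.im - t m * l.im = τ * (l.im - m.im) ∧
      t l * s' - t m * s = τ * (s + t l - s' - t m) := by
    intro s s'
    obtain ⟨τ, hτ⟩ := ht ⟨s, l.im⟩ ⟨s', m.im⟩ hl hm
    rw [line ⟨s, l.im⟩ l hl rfl, line ⟨s', m.im⟩ m hm rfl] at hτ
    have him := congrArg Complex.im hτ
    have hre := congrArg Complex.re hτ
    simp at him hre
    exact ⟨τ, him, hre⟩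
  have hne : l.im - m.im ≠ 0 := sub_ne_zero.2 hlm
  obtain ⟨τ₀, him₀, hre₀⟩ := key 0 0
  obtain ⟨τ₁, him₁, hre₁⟩ := key 1 0
  obtain ⟨τ₂, him₂, hre₂⟩ := key 0 1
  obtain rfl : τ₀ = τ₁ := mul_right_cancel₀ hne (him₀.symm.trans him₁)
  obtain rfl : τ₀ = τ₂ := mul_right_cancel₀ hne (him₀.symm.trans him₂)
  linarith

lemma not_isUnit_of_not_isUnit_mul_mul {M : Type*} [Monoid M] {u z m : M} (hu : IsUnit u) (hz : IsUnit z)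
    (h : ¬ IsUnit (u * m * z)) : ¬ IsUnit m :=
  fun hm => h ((hu.mul hm).mul hz)

variable [StarRing A]

lemma SpectrallyMultiplicative.exists_map_mul_add_mul_of_im_ne_zero
    (hHerm : ∀ a : A, star a = a → ∀ z ∈ spectrum ℂ a, z.im = 0)
    (hsm : SpectrallyMultiplicative φ) {a u z : A} (ha : star a = a)
    (hu : IsUnit u) (hz : IsUnit z) :
    ∃ r : ℝ, ∀ l : ℂ, l.im ≠ 0 → φ (u * (l • 1 + a) * z) = (l + r) * φ (u * z) := by
  have hF := hsm.map_ne_zero (hu.mul hz)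
  have hreal : ∀ l : ℂ, ∃ t : ℝ, φ (u * (l • 1 + a) * z) = (l + t) * φ (u * z) := by
    intro l
    have h := hsm.not_isUnit_sub (u * (l • 1 + a) * z) (hu.mul hz)
    obtain ⟨τ, hτ⟩ := exists_real_of_not_isUnit hHerm ha
      (p := φ (u * (l • 1 + a) * z) - l * φ (u * z)) (e := -φ (u * z)) <| by
        refine not_isUnit_of_not_isUnit_mul_mul hu hz ?_
        convert h using 2
        simp only [add_mul, mul_add, smul_mul_assoc, mul_smul_comm, mul_one]
        module
    refine ⟨-τ, ?_⟩
    push_cast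
    linear_combination hτ
  choose t ht using hreal
  refine ⟨t Complex.I, fun l hl => ?_⟩
  rw [ht, eq_of_exists_real_proportional (t := t) ?_ hl (m := Complex.I) (by simp)]
  intro l m hl hm
  have h := hsm.not_isUnit_sub (u * (l • 1 + a) * z)
    ((hu.mul (isUnit_smul_one_add hHerm ha hm)).mul hz)
  rw [ht l, ht m] at h
  obtain ⟨τ, hτ⟩ := exists_real_of_not_isUnit hHerm ha
    (p := ((l + t l) * m - (m + t m) * l) * φ (u * z))
    (e := (l + t l - m - t m) * φ (u * z)) <| by
      refine not_isUnit_of_not_isUnit_mul_mul hu hz ?_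
      convert h using 2
      simp only [add_mul, mul_add, smul_mul_assoc, mul_smul_comm, mul_one]
      module
  refine ⟨τ, mul_right_cancel₀ hF ?_⟩
  linear_combination hτ

lemma SpectrallyMultiplicative.exists_map_mul_add_mul
    (hHerm : ∀ a : A, star a = a → ∀ z ∈ spectrum ℂ a, z.im = 0)
    (hsm : SpectrallyMultiplicative φ) (hcont : Continuous φ) {a u z : A} (ha : star a = a)
    (hu : IsUnit u) (hz : IsUnit z) :
    ∃ r : ℝ, ∀ l : ℂ, φ (u * (l • 1 + a) * z) = (l + r) * φ (u * z) := by
  obtain ⟨r, hr⟩ := hsm.exists_map_mul_add_mul_of_im_ne_zero hHerm ha hu hz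
  have hd : Dense {l : ℂ | l.im ≠ 0} :=
    (dense_compl_singleton (0 : ℝ)).preimage Complex.isOpenMap_im
  exact ⟨r, fun l => congrFun (Continuous.ext_on hd (by fun_prop) (by fun_prop) hr) l⟩

lemma SpectrallyMultiplicative.map_selfAdjoint_im
    (hHerm : ∀ a : A, star a = a → ∀ z ∈ spectrum ℂ a, z.im = 0)
    (hsm : SpectrallyMultiplicative φ) (h1 : φ 1 = 1) {a : A} (ha : star a = a) :
    (φ a).im = 0 :=
  hHerm a ha _ (hsm.mem_spectrum h1 a)

lemma SpectrallyMultiplicative.map_smul_one_add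
    (hHerm : ∀ a : A, star a = a → ∀ z ∈ spectrum ℂ a, z.im = 0)
    (hsm : SpectrallyMultiplicative φ) (hcont : Continuous φ) (h1 : φ 1 = 1)
    {a : A} (ha : star a = a) (l : ℂ) : φ (l • 1 + a) = l + φ a := by
  obtain ⟨r, hr⟩ := hsm.exists_map_mul_add_mul hHerm hcont ha isUnit_one isUnit_one
  simp only [one_mul, mul_one, h1] at hr
  have h0 := hr 0
  simp only [zero_smul, zero_add] at h0
  rw [hr, h0]

/-- `φ` is multiplicative on products of two translates of self-adjoint elements. -/
lemma SpectrallyMultiplicative.map_smul_one_add_mul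
    (hHerm : ∀ a : A, star a = a → ∀ z ∈ spectrum ℂ a, z.im = 0)
    (hsm : SpectrallyMultiplicative φ) (hcont : Continuous φ) (h1 : φ 1 = 1)
    {a b : A} (ha : star a = a) (hb : star b = b) (l : ℂ) {m : ℂ} (hm : m.im ≠ 0) :
    φ ((l • 1 + a) * (m • 1 + b)) = (l + φ a) * (m + φ b) := by
  have hL : ∀ l : ℂ, l.im ≠ 0 → ∃ r : ℝ, ∀ m : ℂ,
      φ ((l • 1 + a) * (m • 1 + b)) = (m + r) * (l + φ a) := by
    intro l hl
    obtain ⟨r, hr⟩ := hsm.exists_map_mul_add_mul hHerm hcont hb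
      (isUnit_smul_one_add hHerm ha hl) isUnit_one
    simp only [mul_one, hsm.map_smul_one_add hHerm hcont h1 ha] at hr
    exact ⟨r, hr⟩
  obtain ⟨q, hq⟩ := hsm.exists_map_mul_add_mul hHerm hcont ha
    isUnit_one (isUnit_smul_one_add hHerm hb hm)
  simp only [one_mul, hsm.map_smul_one_add hHerm hcont h1 hb] at hq
  obtain ⟨α, hα⟩ : ∃ α : ℝ, φ a = α :=
    ⟨(φ a).re, Complex.ext (by simp) (by simp [hsm.map_selfAdjoint_im hHerm h1 ha])⟩
  obtain ⟨β, hβ⟩ : ∃ β : ℝ, φ b = β :=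
    ⟨(φ b).re, Complex.ext (by simp) (by simp [hsm.map_selfAdjoint_im hHerm h1 hb])⟩
  rw [hα] at hL
  rw [hβ] at hq
  -- `(l + α) * (r l - β)` does not depend on `l`, while `r l - β` is real
  have hconst : ∀ l : ℂ, l.im ≠ 0 → ∃ d : ℝ, (l + α) * d = (m + β) * (q - α) := by
    intro l hl
    obtain ⟨r, hr⟩ := hL l hl
    refine ⟨r - β, ?_⟩
    push_cast
    linear_combination (hr m).symm.trans (hq l)
  obtain ⟨d, hd⟩ := hconst (Complex.I - α) (by simp)
  obtain ⟨d', hd'⟩ := hconst (1 + Complex.I - α) (by simp)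
  have hdd := hd.trans hd'.symm
  have hre := congrArg Complex.re hdd
  have him := congrArg Complex.im hdd
  simp at hre him
  have hd0 : d = 0 := him.trans hre.symm
  have hmβ : m + β ≠ 0 := fun h => hm (by simpa using congrArg Complex.im h)
  have hqα : (q : ℂ) - α = 0 := by
    rw [hd0] at hd
    simpa [hmβ] using hd.symm
  rw [hq, hα, hβ]
  linear_combination (m + β) * hqα

lemma SpectrallyMultiplicative.map_mul_self_s7
    (hHerm : ∀ a : A, star a = a → ∀ z ∈ spectrum ℂ a, z.im = 0)
    (hsm : SpectrallyMultiplicative φ) (hcont : Continuous φ) (h1 : φ 1 = 1)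
    {a : A} (ha : star a = a) : φ (a * a) = φ a * φ a := by
  have hd : Dense {l : ℂ | l.im ≠ 0} :=
    (dense_compl_singleton (0 : ℝ)).preimage Complex.isOpenMap_im
  have h := congrFun (Continuous.ext_on (f := fun l : ℂ => φ ((l • 1 + a) * (l • 1 + a)))
    (g := fun l => (l + φ a) * (l + φ a)) hd (by fun_prop) (by fun_prop)
    fun _ hl => hsm.map_smul_one_add_mul hHerm hcont h1 ha ha _ hl) 0
  simpa using h

lemma SpectrallyMultiplicative.map_add [CompleteSpace A]
    (hHerm : ∀ a : A, star a = a → ∀ z ∈ spectrum ℂ a, z.im = 0)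
    (hsm : SpectrallyMultiplicative φ) (hcont : Continuous φ) (h1 : φ 1 = 1)
    {a b : A} (ha : star a = a) (hb : star b = b) : φ (a + b) = φ a + φ b := by
  have hab : star (a + b) = a + b := by rw [star_add, ha, hb]
  set D := φ a + φ b - φ (a + b) with hD
  by_contra hne
  have hD0 : D ≠ 0 := fun h => hne (by linear_combination -h)
  set E : A := (φ a + φ b - φ (a + b)) • (a + b) + (φ a * φ b) • (1 : A) - a * b with hE
  set F : A := (φ a * φ b) • (a + b) - φ (a + b) • (a * b) with hF
  let f : ℝ → A := fun s => D • (1 : A) + (s * Complex.I) • E + (s * Complex.I) ^ 2 • F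
  have hf : Continuous f := by fun_prop
  have hev : ∀ᶠ s in nhds (0 : ℝ), IsUnit (f s) := by
    have hopen : IsOpen (f ⁻¹' {x | IsUnit x}) := Units.isOpen.preimage hf
    refine hopen.mem_nhds ?_
    simpa [f] using (isUnit_one (M := A)).smul (Units.mk0 D hD0)
  obtain ⟨s, hs, hs0⟩ := ((hev.filter_mono nhdsWithin_le_nhds).and
    (self_mem_nhdsWithin : ({0}ᶜ : Set ℝ) ∈ nhdsWithin 0 {0}ᶜ)).exists
  have hs0' : (s : ℂ) ≠ 0 := by simpa using hs0
  have ht0 : (s : ℂ) * Complex.I ≠ 0 := mul_ne_zero hs0' Complex.I_ne_zero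
  set t : ℂ := s * Complex.I with ht
  have hl : (t⁻¹).im ≠ 0 := by
    simpa [ht] using hs0
  have h := hsm.not_isUnit_sub ((t⁻¹ • 1 + a) * (t⁻¹ • 1 + b))
    (isUnit_smul_one_add hHerm hab hl)
  rw [hsm.map_smul_one_add_mul hHerm hcont h1 ha hb _ hl,
    hsm.map_smul_one_add hHerm hcont h1 hab] at h
  apply h
  convert hs.smul (Units.mk0 ((t ^ 2)⁻¹) (inv_ne_zero (pow_ne_zero 2 ht0))) using 1
  change _ = (t ^ 2)⁻¹ • (D • (1 : A) + t • E + t ^ 2 • F)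
  rw [hE, hF, hD]
  simp only [add_mul, mul_add, smul_mul_assoc, mul_smul_comm, mul_one, one_mul]
  match_scalars <;> field_simp <;> ring

lemma SpectrallyMultiplicative.map_mul_add_mul [CompleteSpace A]
    (hHerm : ∀ a : A, star a = a → ∀ z ∈ spectrum ℂ a, z.im = 0)
    (hsm : SpectrallyMultiplicative φ) (hcont : Continuous φ) (h1 : φ 1 = 1)
    {a b : A} (ha : star a = a) (hb : star b = b) : φ (a * b + b * a) = 2 * φ a * φ b := by
  have hab : star (a + b) = a + b := by rw [star_add, ha, hb]
  have haa : star (a * a) = a * a := by rw [star_mul, ha]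
  have hbb : star (b * b) = b * b := by rw [star_mul, hb]
  have hj : star (a * b + b * a) = a * b + b * a := by
    rw [star_add, star_mul, star_mul, ha, hb, add_comm]
  have h := hsm.map_mul_self_s7 hHerm hcont h1 hab
  have hexp : (a + b) * (a + b) = a * a + b * b + (a * b + b * a) := by noncomm_ring
  rw [hexp, hsm.map_add hHerm hcont h1 (by rw [star_add, haa, hbb]) hj,
    hsm.map_add hHerm hcont h1 haa hbb, hsm.map_add hHerm hcont h1 ha hb,
    hsm.map_mul_self_s7 hHerm hcont h1 ha, hsm.map_mul_self_s7 hHerm hcont h1 hb] at h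
  linear_combination h

lemma SpectrallyMultiplicative.map_mul_mul_self_eq_zero [CompleteSpace A]
    (hHerm : ∀ a : A, star a = a → ∀ z ∈ spectrum ℂ a, z.im = 0)
    (hsm : SpectrallyMultiplicative φ) (hcont : Continuous φ) (h1 : φ 1 = 1)
    {a y : A} (ha : star a = a) (hy : star y = y) (h0 : φ a = 0) : φ (a * y * a) = 0 := by
  have haa : star (a * a) = a * a := by rw [star_mul, ha]
  have hj : star (a * y + y * a) = a * y + y * a := by
    rw [star_add, star_mul, star_mul, ha, hy, add_comm]
  have hj' : star (a * a * y + y * (a * a)) = a * a * y + y * (a * a) := by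
    rw [star_add, star_mul _ y, star_mul y, haa, hy, add_comm]
  have haya : star (a * y * a) = a * y * a := by simp only [star_mul, ha, hy, mul_assoc]
  have h := hsm.map_mul_add_mul hHerm hcont h1 ha hj
  have hexp : a * (a * y + y * a) + (a * y + y * a) * a =
      a * y * a + a * y * a + (a * a * y + y * (a * a)) := by noncomm_ring
  rw [hexp, hsm.map_add hHerm hcont h1 (by rw [star_add, haya]) hj',
    hsm.map_add hHerm hcont h1 haya haya, hsm.map_mul_add_mul hHerm hcont h1 haa hy,
    hsm.map_mul_self_s7 hHerm hcont h1 ha, h0] at h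
  linear_combination h / 2

lemma SpectrallyMultiplicative.map_star_mul_self_eq_zero [CompleteSpace A] [StarModule ℂ A]
    (hHerm : ∀ a : A, star a = a → ∀ z ∈ spectrum ℂ a, z.im = 0)
    (hsm : SpectrallyMultiplicative φ) (hcont : Continuous φ) (h1 : φ 1 = 1)
    {a b : A} (ha : star a = a) (hb : star b = b) (ha0 : φ a = 0) (hb0 : φ b = 0) :
    φ (star (a + Complex.I • b) * (a + Complex.I • b)) = 0 := by
  have haa : star (a * a) = a * a := by rw [star_mul, ha]
  have hbb : star (b * b) = b * b := by rw [star_mul, hb]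
  have hj : star (a * b + b * a) = a * b + b * a := by
    rw [star_add, star_mul, star_mul, ha, hb, add_comm]
  set c : A := Complex.I • (a * b - b * a) with hc
  have hcs : star c = c := by
    rw [hc, star_smul, star_sub, star_mul, star_mul, ha, hb, Complex.star_def, Complex.conj_I]
    module
  have hp : star (a * (b * b) * a) = a * (b * b) * a := by
    simp only [star_mul, ha, hb, mul_assoc]
  have hq : star (b * (a * a) * b) = b * (a * a) * b := by
    simp only [star_mul, ha, hb, mul_assoc]
  have hpq : star (a * (b * b) * a + b * (a * a) * b) = a * (b * b) * a + b * (a * a) * b := by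
    rw [star_add, hp, hq]
  have hcc : c * c + (a * b + b * a) * (a * b + b * a) =
      (a * (b * b) * a + b * (a * a) * b) + (a * (b * b) * a + b * (a * a) * b) := by
    rw [hc, smul_mul_smul_comm, Complex.I_mul_I, neg_one_smul]
    noncomm_ring
  have h := congrArg φ hcc
  rw [hsm.map_add hHerm hcont h1 (by rw [star_mul, hcs]) (by rw [star_mul, hj]),
    hsm.map_add hHerm hcont h1 hpq hpq, hsm.map_add hHerm hcont h1 hp hq,
    hsm.map_mul_self_s7 hHerm hcont h1 hcs, hsm.map_mul_self_s7 hHerm hcont h1 hj,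
    hsm.map_mul_add_mul hHerm hcont h1 ha hb,
    hsm.map_mul_mul_self_eq_zero hHerm hcont h1 ha hbb ha0,
    hsm.map_mul_mul_self_eq_zero hHerm hcont h1 hb haa hb0, ha0, hb0] at h
  have hc0 : φ c = 0 := by simpa using h
  have hexp : star (a + Complex.I • b) * (a + Complex.I • b) = a * a + b * b + c := by
    rw [hc, star_add, star_smul, ha, hb, Complex.star_def, Complex.conj_I]
    simp only [add_mul, mul_add, smul_mul_assoc, mul_smul_comm]
    match_scalars <;> first | ring1 | linear_combination -Complex.I_sq
  rw [hexp, hsm.map_add hHerm hcont h1 (by rw [star_add, haa, hbb]) hcs,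
    hsm.map_add hHerm hcont h1 haa hbb, hsm.map_mul_self_s7 hHerm hcont h1 ha,
    hsm.map_mul_self_s7 hHerm hcont h1 hb, ha0, hb0, hc0]
  simp

/-- A shifted square of a self-adjoint element plus a skew-adjoint element is invertible. -/
lemma isUnit_mul_self_add_add_skew [StarModule ℂ A]
    (hHerm : ∀ a : A, star a = a → ∀ z ∈ spectrum ℂ a, z.im = 0) {g k : A} (hg : star g = g)
    (hk : star k = -k) {η : ℝ} (hη : η ≠ 0) :
    IsUnit (g * g + ((η : ℂ) ^ 2) • (1 : A) + k) := by
  obtain ⟨T, hT⟩ := isUnit_smul_one_add hHerm hg (l := η * Complex.I) (by simpa using hη)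
  have hTs : star (T : A) = (-(η * Complex.I)) • 1 + g := by
    rw [hT, star_add, star_smul, star_one, hg]
    simp
  have hprod : (T : A) * star (T : A) = g * g + ((η : ℂ) ^ 2) • (1 : A) := by
    rw [hTs, hT]
    simp only [add_mul, mul_add, smul_mul_assoc, mul_smul_comm, one_mul, mul_one]
    match_scalars <;> first | ring1 | linear_combination (-(η : ℂ) ^ 2) * Complex.I_sq
  set k' : A := ↑T⁻¹ * k * star (↑T⁻¹ : A) with hk'
  have hk's : star k' = -k' := by
    simp only [hk', star_mul, star_star, hk, mul_assoc, neg_mul, mul_neg]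
  have hl : star ((-Complex.I) • k') = (-Complex.I) • k' := by
    rw [star_smul, hk's]
    simp
  have hu := (isUnit_smul_one_add hHerm hl (l := -Complex.I) (by simp)).smul
    (Units.mk0 Complex.I Complex.I_ne_zero)
  have hTu : IsUnit (star (T : A)) := T.isUnit.star
  convert (T.isUnit.mul hu).mul hTu using 1
  change _ = T * (Complex.I • ((-Complex.I) • (1 : A) + (-Complex.I) • k')) * star (T : A)
  have h1 : Complex.I • ((-Complex.I) • (1 : A) + (-Complex.I) • k') = 1 + k' := by
    rw [smul_add, smul_smul, smul_smul]
    simp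
  have h2 : star (↑T⁻¹ : A) * star (T : A) = 1 := by
    rw [← star_mul, Units.mul_inv, star_one]
  rw [h1, mul_add, add_mul, mul_one, hprod, hk']
  congr 1
  rw [mul_assoc (T : A), mul_assoc (↑T⁻¹ * k), h2, mul_one, ← mul_assoc, Units.mul_inv, one_mul]

/-- Left invertibility of `x⋆x + iδ - m x` for `|m|⁴ < 4 δ²`. -/
lemma exists_mul_eq_one_of_normSq_sq_lt [StarModule ℂ A]
    (hHerm : ∀ a : A, star a = a → ∀ z ∈ spectrum ℂ a, z.im = 0) (x : A) {δ : ℝ} {m : ℂ}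
    (hm : Complex.normSq m ^ 2 < 4 * δ ^ 2) :
    ∃ y : A, y * (((δ * Complex.I : ℂ)) • 1 + star x * x - m • x) = 1 := by
  set n := Complex.normSq m with hn
  have hpos : 0 < δ ^ 2 - n ^ 2 / 4 := by linarith
  set η := Real.sqrt (δ ^ 2 - n ^ 2 / 4) with hη
  have hη0 : η ≠ 0 := (Real.sqrt_pos.2 hpos).ne'
  have hη2 : (η : ℂ) ^ 2 = δ ^ 2 - n ^ 2 / 4 := by
    have : η ^ 2 = δ ^ 2 - n ^ 2 / 4 := Real.sq_sqrt hpos.le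
    exact_mod_cast congrArg (Complex.ofReal) this
  set h : A := star x * x with hh
  have hhs : star h = h := by rw [hh, star_mul, star_star]
  set R : A := (δ * Complex.I : ℂ) • 1 + h with hR
  have hRs : star R = (-(δ * Complex.I) : ℂ) • 1 + h := by
    rw [hR, star_add, star_smul, star_one, hhs]
    simp
  have hgs : star (h + (-(n / 2) : ℂ) • (1 : A)) = h + (-(n / 2) : ℂ) • (1 : A) := by
    rw [star_add, star_smul, star_one, hhs]
    simp
  have hks : star ((starRingEnd ℂ m) • (star x * R) - m • (star R * x)) =
      -((starRingEnd ℂ m) • (star x * R) - m • (star R * x)) := by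
    rw [star_sub, star_smul, star_smul, star_mul, star_mul, star_star, star_star]
    simp
  obtain ⟨U, hU⟩ := isUnit_mul_self_add_add_skew hHerm hgs hks hη0
  refine ⟨↑U⁻¹ * (star R + (starRingEnd ℂ m) • star x), ?_⟩
  rw [mul_assoc, Units.inv_mul_eq_iff_eq_mul, mul_one, hU, hη2]
  have hmm : (starRingEnd ℂ m) * m = n := by rw [mul_comm, Complex.mul_conj]
  have hI : (-(δ * Complex.I)) * (δ * Complex.I) = (δ : ℂ) ^ 2 := by
    linear_combination (-(δ : ℂ) ^ 2) * Complex.I_sq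
  have hRR : star R * R = h * h + ((δ : ℂ) ^ 2) • (1 : A) := by
    rw [hRs, hR, ← hI]
    simp only [add_mul, mul_add, smul_mul_assoc, mul_smul_comm, one_mul, mul_one]
    module
  have hexp : (star R + (starRingEnd ℂ m) • star x) * (R - m • x) =
      star R * R + ((starRingEnd ℂ m) • (star x * R) - m • (star R * x)) - (n : ℂ) • h := by
    rw [hh, ← hmm]
    simp only [add_mul, mul_sub, smul_mul_assoc, mul_smul_comm]
    module
  rw [hexp, hRR]
  simp only [add_mul, mul_add, smul_mul_assoc, mul_smul_comm, one_mul, mul_one]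
  module

lemma isUnit_one_sub_smul_mul [StarModule ℂ A]
    (hHerm : ∀ a : A, star a = a → ∀ z ∈ spectrum ℂ a, z.im = 0) (x : A) {δ : ℝ} {m : ℂ}
    (hm : Complex.normSq m ^ 2 < 4 * δ ^ 2) {R : Aˣ}
    (hR : (R : A) = (δ * Complex.I : ℂ) • 1 + star x * x) :
    IsUnit (1 - m • (x * ↑R⁻¹)) := by
  have hδ : δ ≠ 0 := by
    rintro rfl
    nlinarith [sq_nonneg (Complex.normSq m)]
  have hxx : star (x * star x) = x * star x := by rw [star_mul, star_star]
  obtain ⟨S, hS⟩ := isUnit_smul_one_add hHerm hxx (l := δ * Complex.I) (by simpa using hδ)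
  have hSx : (S : A) * x = x * R := by
    rw [hS, hR]
    simp only [add_mul, mul_add, smul_mul_assoc, mul_smul_comm, one_mul, mul_one, mul_assoc]
  have hSx' : x * (↑R⁻¹ : A) = ↑S⁻¹ * x := by
    rw [Units.mul_inv_eq_iff_eq_mul, mul_assoc, ← hSx, Units.inv_mul_cancel_left]
  obtain ⟨y, hy⟩ := exists_mul_eq_one_of_normSq_sq_lt hHerm x hm
  have hm' : Complex.normSq (starRingEnd ℂ m) ^ 2 < 4 * (-δ) ^ 2 := by
    simpa [Complex.normSq_conj] using hm
  obtain ⟨w, hw⟩ := exists_mul_eq_one_of_normSq_sq_lt hHerm (star x) hm'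
  have hw' : ((S : A) - m • x) * star w = 1 := by
    have := congrArg star hw
    rw [star_mul, star_sub, star_add, star_smul, star_smul, star_star, hxx, star_one] at this
    rw [hS]
    simpa using this
  have hleft : (R * y) * (1 - m • (x * ↑R⁻¹)) = 1 := by
    have : (1 : A) - m • (x * ↑R⁻¹) = (R - m • x) * ↑R⁻¹ := by
      rw [sub_mul, Units.mul_inv, smul_mul_assoc]
    rw [this, mul_assoc, ← mul_assoc y, hR, hy, ← hR, one_mul, Units.mul_inv]
  have hright : (1 - m • (x * ↑R⁻¹)) * (star w * S) = 1 := by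
    have : (1 : A) - m • (x * ↑R⁻¹) = ↑S⁻¹ * (S - m • x) := by
      rw [mul_sub, Units.inv_mul, mul_smul_comm, hSx']
    rw [this, mul_assoc, ← mul_assoc _ (star w), hw', one_mul, Units.inv_mul]
  exact isUnit_iff_exists_and_exists.2 ⟨⟨_, hright⟩, ⟨_, hleft⟩⟩

end Helpers

theorem stmt_7 {A : Type*} [NormedRing A] [NormedAlgebra ℂ A] [CompleteSpace A]
    [StarRing A] [StarModule ℂ A]
    (hHerm : ∀ a : A, star a = a → ∀ z ∈ spectrum ℂ a, z.im = 0)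
    (φ : A → ℂ) (hcont : Continuous φ) (hsm : SpectrallyMultiplicative φ)
    (h1 : φ 1 = 1) (x : A) (hx : φ (reP x) + Complex.I * φ (imP x) = 0) :
    φ x = 0 := by
  have ha : star (reP x) = reP x := by
    simp [reP, star_smul, add_comm]
  have hb : star (imP x) = imP x := by
    simp only [imP, star_smul, star_sub, star_star, star_inv₀, star_mul', Complex.star_def,
      Complex.conj_I, map_ofNat, mul_neg, inv_neg]
    module
  have hxab : reP x + Complex.I • imP x = x := by
    have hI : Complex.I * ((2 : ℂ) * Complex.I)⁻¹ = 2⁻¹ := by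
      field_simp
    rw [reP, imP, smul_smul, hI]
    module
  have ha_im := hsm.map_selfAdjoint_im hHerm h1 ha
  have hb_im := hsm.map_selfAdjoint_im hHerm h1 hb
  have ha0 : φ (reP x) = 0 :=
    Complex.ext (by simpa [hb_im] using congrArg Complex.re hx) ha_im
  have hb0 : φ (imP x) = 0 := by simpa [ha0] using hx
  have hh0 : φ (star x * x) = 0 := by
    have := hsm.map_star_mul_self_eq_zero hHerm hcont h1 ha hb ha0 hb0
    rwa [hxab] at this
  by_contra hc
  have hnc : 0 < Complex.normSq (φ x) := Complex.normSq_pos.2 hc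
  have hhs : star (star x * x) = star x * x := by rw [star_mul, star_star]
  set δ : ℝ := Complex.normSq (φ x) with hδ
  have hδI : (δ : ℂ) * Complex.I ≠ 0 :=
    mul_ne_zero (Complex.ofReal_ne_zero.2 hnc.ne') Complex.I_ne_zero
  obtain ⟨R, hR⟩ := isUnit_smul_one_add hHerm hhs (l := δ * Complex.I) (by simpa using hnc.ne')
  have hφR : φ R = δ * Complex.I := by
    rw [hR, hsm.map_smul_one_add hHerm hcont h1 hhs, hh0, add_zero]
  have hφR' : φ ↑R⁻¹ = (δ * Complex.I)⁻¹ := by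
    rw [← hφR]
    exact (inv_eq_of_mul_eq_one_right (hsm.map_mul_map_inv_s7 R)).symm
  have hm : Complex.normSq (δ * Complex.I / φ x) ^ 2 < 4 * δ ^ 2 := by
    rw [Complex.normSq_div, Complex.normSq_mul, Complex.normSq_ofReal, Complex.normSq_I, ← hδ,
      mul_one, mul_div_cancel_right₀ _ hnc.ne']
    nlinarith
  have hu := (isUnit_one_sub_smul_mul hHerm x hm hR).smul
    (Units.mk0 (φ x / (δ * Complex.I)) (div_ne_zero hc hδI))
  have hmem := hsm x ↑R⁻¹
  rw [spectrum.mem_iff, Algebra.algebraMap_eq_smul_one, hφR'] at hmem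
  apply hmem
  convert hu using 1
  change _ = (φ x / (δ * Complex.I)) • ((1 : A) - _ • _)
  rw [smul_sub, smul_smul, div_mul_div_cancel₀ hδI, div_self hc, one_smul, div_eq_mul_inv]
end

section
/- Let A be a Hermitian algebra and suppose x ∈ A is normal modulo the Jacobson radical, i.e. x⋆·x − x·x⋆ ∈ rad(A). Then s(x) = ρ(x), where s is the Pták functional and ρ the spectral radius. -/
open scoped ComplexConjugate

open scoped ENNReal

/-- The norm of the quotient of a normed ring by a closed two-sided ideal. -/
noncomputable abbrev Ideal.Quotient.normedRingOfIsTwoSided {R : Type*} [NormedRing R] (I : Ideal R)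
    [I.IsTwoSided] [IsClosed (I : Set R)] : NormedRing (R ⧸ I) :=
  { Ideal.Quotient.ring I, Submodule.Quotient.normedAddCommGroup I with
    norm_mul_le x y := by
      refine ge_of_tendsto (f := fun ε : ℝ => (‖x‖ + ε) * (‖y‖ + ε))
        (x := nhdsWithin 0 (Set.Ioi 0)) ?_ ?_
      · have : Continuous fun ε : ℝ => (‖x‖ + ε) * (‖y‖ + ε) := by fun_prop
        simpa using (this.tendsto 0).mono_left nhdsWithin_le_nhds
      · filter_upwards [self_mem_nhdsWithin] with ε hε
        obtain ⟨a, rfl, ha⟩ := Submodule.Quotient.norm_mk_lt x hε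
        obtain ⟨b, rfl, hb⟩ := Submodule.Quotient.norm_mk_lt y hε
        calc
          _ ≤ ‖a * b‖ := Submodule.Quotient.norm_mk_le I (a * b)
          _ ≤ ‖a‖ * ‖b‖ := norm_mul_le a b
          _ ≤ _ := mul_le_mul ha.le hb.le (norm_nonneg b) ((norm_nonneg a).trans ha.le) }

theorem Ideal.isClosed_jacobson {R : Type*} [NormedRing R] [CompleteSpace R] (I : Ideal R) :
    IsClosed (I.jacobson : Set R) := by
  rw [Ideal.jacobson, Submodule.coe_sInf]
  exact isClosed_biInter fun J hJ => @Ideal.IsMaximal.isClosed _ _ _ J hJ.2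

theorem Ideal.isUnit_of_sub_one_mem_jacobson_bot_of_ring {R : Type*} [Ring R] {r : R}
    (h : r - 1 ∈ Ideal.jacobson (⊥ : Ideal R)) : IsUnit r := by
  have key : ∀ s : R, s - 1 ∈ Ideal.jacobson (⊥ : Ideal R) → ∃ t, t * s = 1 := fun s hs => by
    simpa [sub_eq_zero] using Ideal.exists_mul_sub_mem_of_sub_one_mem_jacobson s hs
  obtain ⟨t, ht⟩ := key r h
  obtain ⟨u, hu⟩ := key t <| by
    have : t - 1 = -(t * (r - 1)) := by rw [mul_sub, ht]; simp
    rw [this]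
    exact neg_mem (Ideal.mul_mem_left _ t h)
  have hur : u = r := by rw [← mul_one u, ← ht, ← mul_assoc, hu, one_mul]
  exact ⟨⟨r, t, hur ▸ hu, ht⟩, rfl⟩

theorem Ideal.Quotient.isUnit_mk_jacobson_bot_iff {R : Type*} [Ring R] {r : R} :
    IsUnit (Ideal.Quotient.mk (Ideal.jacobson (⊥ : Ideal R)) r) ↔ IsUnit r := by
  refine ⟨fun h => ?_, fun h => h.map _⟩
  obtain ⟨s, h₁, h₂⟩ := isUnit_iff_exists.1 h
  obtain ⟨s, rfl⟩ := Ideal.Quotient.mk_surjective s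
  rw [← map_mul, ← map_one (Ideal.Quotient.mk _), Ideal.Quotient.eq] at h₁ h₂
  obtain ⟨u, hu⟩ := Ideal.isUnit_of_sub_one_mem_jacobson_bot_of_ring h₁
  obtain ⟨v, hv⟩ := Ideal.isUnit_of_sub_one_mem_jacobson_bot_of_ring h₂
  refine isUnit_iff_exists_and_exists.2 ⟨⟨s * ↑u⁻¹, ?_⟩, ⟨↑v⁻¹ * s, ?_⟩⟩
  · rw [← mul_assoc, ← hu, Units.mul_inv]
  · rw [mul_assoc, ← hv, Units.inv_mul]

theorem spectrum_mk_jacobson_bot {R : Type*} [Ring R] [Algebra ℂ R] (r : R) :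
    spectrum ℂ (Ideal.Quotient.mk (Ideal.jacobson (⊥ : Ideal R)) r) = spectrum ℂ r := by
  ext z
  rw [spectrum.mem_iff, spectrum.mem_iff, ← Ideal.Quotient.isUnit_mk_jacobson_bot_iff (r := _ - r),
    map_sub]
  rfl

/-- Any two commuting elements of a complex Banach algebra lie in a common commutative Banach
subalgebra with the same spectra, namely their double centralizer. The spectrum of an element of
this subalgebra is therefore the set of its values at characters. -/
theorem exists_subalgebra_mem_spectrum_iff {B : Type*} [NormedRing B] [NormedAlgebra ℂ B]
    [CompleteSpace B] {a b : B} (hab : Commute a b) :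
    ∃ C : Subalgebra ℂ B, a ∈ C ∧ b ∈ C ∧
      ∀ (c : C) (z : ℂ), z ∈ spectrum ℂ (c : B) ↔ ∃ f : C →ₐ[ℂ] ℂ, f c = z := by
  set S : Set B := {a, b}
  have hS : ∀ x ∈ S, ∀ y ∈ S, x * y = y * x := by
    rintro x (rfl | rfl) y (rfl | rfl)
    exacts [rfl, hab, hab.symm, rfl]
  let C := Subalgebra.centralizer ℂ (Subalgebra.centralizer ℂ S : Set B)
  have hC : ∀ x, x ∈ C ↔ x ∈ S.centralizer.centralizer := fun x => Iff.rfl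
  have hSC : S ⊆ C := Set.subset_centralizer_centralizer
  refine ⟨C, hSC (by simp [S]), hSC (by simp [S]), fun c z => ?_⟩
  have hclosed : IsClosed (C : Set B) := Set.isClosed_centralizer _
  have : CompleteSpace C := hclosed.completeSpace_coe
  let : NormedCommRing C :=
    { (inferInstance : NormedRing C) with
      mul_comm := fun x y => Subtype.ext <|
        Set.centralizer_centralizer_comm_of_comm hS _ x.2 _ y.2 }
  have hspec : z ∈ spectrum ℂ (c : B) ↔ z ∈ spectrum ℂ c := by
    refine not_iff_not.1 ?_
    rw [spectrum.notMem_iff, spectrum.notMem_iff]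
    refine ⟨fun h => ?_, fun h => h.map C.val⟩
    obtain ⟨u, hu⟩ := h
    have huC : (u : B) ∈ C := hu ▸ (algebraMap ℂ C z - c).2
    have huC' : (↑u⁻¹ : B) ∈ C := fun x hx => (Commute.units_inv_right (huC x hx) : _)
    refine isUnit_iff_exists.2 ⟨⟨_, huC'⟩, Subtype.ext ?_, Subtype.ext ?_⟩
    · exact (congrArg (· * (↑u⁻¹ : B)) hu.symm).trans u.mul_inv
    · exact (congrArg ((↑u⁻¹ : B) * ·) hu.symm).trans u.inv_mul
  rw [hspec, WeakDual.CharacterSpace.mem_spectrum_iff_exists]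
  exact ⟨fun ⟨f, hf⟩ => ⟨WeakDual.CharacterSpace.equivAlgHom f, hf⟩,
    fun ⟨f, hf⟩ => ⟨WeakDual.CharacterSpace.equivAlgHom.symm f, hf⟩⟩

theorem spectralRadius_mul_eq_sq_of_commute {B : Type*} [NormedRing B] [NormedAlgebra ℂ B]
    [CompleteSpace B] {a b : B} (hab : Commute a b) (hre : ∀ z ∈ spectrum ℂ (a + b), z.im = 0)
    (him : ∀ z ∈ spectrum ℂ (Complex.I • (a - b)), z.im = 0) :
    spectralRadius ℂ (b * a) = spectralRadius ℂ a ^ 2 := by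
  obtain ⟨C, ha, hb, hC⟩ := exists_subalgebra_mem_spectrum_iff hab
  lift a to C using ha
  lift b to C using hb
  have hconj (f : C →ₐ[ℂ] ℂ) : f b = conj (f a) := by
    have h₁ := hre (f (a + b)) ((hC (a + b) _).2 ⟨f, rfl⟩)
    have h₂ := him (f (Complex.I • (a - b))) ((hC (Complex.I • (a - b)) _).2 ⟨f, rfl⟩)
    simp only [map_add, map_smul, map_sub, smul_eq_mul, Complex.add_im, Complex.mul_im,
      Complex.I_re, Complex.I_im, Complex.sub_re] at h₁ h₂
    apply Complex.ext <;> simp only [Complex.conj_re, Complex.conj_im] <;> linarith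
  have hnorm (f : C →ₐ[ℂ] ℂ) : (‖f (b * a)‖₊ : ℝ≥0∞) = (‖f a‖₊ : ℝ≥0∞) ^ 2 := by
    rw [map_mul, hconj, nnnorm_mul, RCLike.nnnorm_conj, sq, ENNReal.coe_mul]
  apply le_antisymm
  · refine iSup₂_le fun z hz => ?_
    obtain ⟨f, rfl⟩ := (hC (b * a) z).1 hz
    rw [hnorm]
    gcongr
    exact le_iSup₂ (α := ℝ≥0∞) (f := fun z _ => (‖z‖₊ : ℝ≥0∞)) (f a) ((hC a _).2 ⟨f, rfl⟩)
  · rw [spectralRadius, ENNReal.iSup₂_pow_of_ne_zero _ two_ne_zero]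
    refine iSup₂_le fun z hz => ?_
    obtain ⟨f, rfl⟩ := (hC a z).1 hz
    rw [← hnorm]
    exact le_iSup₂ (α := ℝ≥0∞) (f := fun z _ => (‖z‖₊ : ℝ≥0∞)) (f (b * a))
      ((hC (b * a) _).2 ⟨f, rfl⟩)

theorem spectralRadius_mul_eq_sq_of_commute_mod_jacobson {A : Type*} [NormedRing A]
    [NormedAlgebra ℂ A] [CompleteSpace A] {a b : A}
    (hab : b * a - a * b ∈ Ideal.jacobson (⊥ : Ideal A))
    (hre : ∀ z ∈ spectrum ℂ (a + b), z.im = 0)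
    (him : ∀ z ∈ spectrum ℂ (Complex.I • (a - b)), z.im = 0) :
    spectralRadius ℂ (b * a) = spectralRadius ℂ a ^ 2 := by
  let J := Ideal.jacobson (⊥ : Ideal A)
  have : IsClosed (J : Set A) := Ideal.isClosed_jacobson ⊥
  let : NormedRing (A ⧸ J) := Ideal.Quotient.normedRingOfIsTwoSided J
  let : NormedAlgebra ℂ (A ⧸ J) :=
    { Ideal.Quotient.algebra ℂ with
      norm_smul_le := (Submodule.Quotient.normedSpace J ℂ).norm_smul_le }
  have : CompleteSpace (A ⧸ J) := Submodule.Quotient.completeSpace J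
  have hrad (y : A) : spectralRadius ℂ (Ideal.Quotient.mk J y) = spectralRadius ℂ y := by
    simp only [spectralRadius]
    rw [spectrum_mk_jacobson_bot]
  have hcomm : Commute (Ideal.Quotient.mk J a) (Ideal.Quotient.mk J b) :=
    (Ideal.Quotient.eq.2 hab).symm
  rw [← hrad, ← hrad, map_mul]
  refine spectralRadius_mul_eq_sq_of_commute hcomm ?_ ?_
  · rw [← map_add]
    exact fun z hz => hre z ((spectrum_mk_jacobson_bot (a + b)).le hz)
  · exact fun z hz => him z ((spectrum_mk_jacobson_bot (Complex.I • (a - b))).le hz)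

theorem stmt_10 {A : Type*} [NormedRing A] [NormedAlgebra ℂ A] [CompleteSpace A]
    [StarRing A] [StarModule ℂ A]
    (hHerm : ∀ a : A, star a = a → ∀ z ∈ spectrum ℂ a, z.im = 0)
    (x : A) (hx : star x * x - x * star x ∈ Ideal.jacobson (⊥ : Ideal A)) :
    ptak x = (spectralRadius ℂ x).toReal := by
  have h := spectralRadius_mul_eq_sq_of_commute_mod_jacobson hx
    (hHerm _ (by simp [add_comm])) (hHerm _ (by simp [star_smul, ← smul_neg]))
  rw [ptak, h, ENNReal.toReal_pow, Real.sqrt_sq ENNReal.toReal_nonneg]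
end

section
/- Let A be a Hermitian algebra and let a ∈ A be self-adjoint with σ(a) ⊆ (0, ∞). Then for every natural number n ≥ 1, the element 1 + i·n·a is invertible in A and s(a·(1 + i·n·a)⁻¹) ≤ 1/n, where s denotes the Pták functional. -/
open scoped ComplexConjugate

theorem isUnit_one_add_smul_of_neg_inv_notMem {A : Type*} [Ring A] [Algebra ℂ A] {a : A} {c : ℂ}
    (hc : c ≠ 0) (h : -c⁻¹ ∉ spectrum ℂ a) : IsUnit (1 + c • a) := by
  rw [spectrum.notMem_iff] at h
  have key : 1 + c • a = algebraMap ℂ A (-c) * (algebraMap ℂ A (-c⁻¹) - a) := by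
    rw [mul_sub, ← map_mul, neg_mul_neg, mul_inv_cancel₀ hc, map_one, ← Algebra.smul_def, neg_smul,
      sub_neg_eq_add]
  rw [key]
  exact ((isUnit_iff_ne_zero.2 (neg_ne_zero.2 hc)).map _).mul h

theorem norm_le_of_mul_one_add_sq_eq_sq {z : ℂ} {m r : ℝ} (hm : 0 < m)
    (h : z * (1 + (m : ℂ) ^ 2 * (r : ℂ) ^ 2) = (r : ℂ) ^ 2) : ‖z‖ ≤ (1 / m) ^ 2 := by
  have h1 : (1 + (m : ℂ) ^ 2 * (r : ℂ) ^ 2) = ((1 + m ^ 2 * r ^ 2 : ℝ) : ℂ) := by push_cast; ring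
  have h2 : ‖z‖ * (1 + m ^ 2 * r ^ 2) = r ^ 2 := by
    have := congrArg norm h
    rw [h1, norm_mul, Complex.norm_real, Real.norm_of_nonneg (by positivity), norm_pow,
      Complex.norm_real, Real.norm_eq_abs, sq_abs] at this
    exact this
  rw [one_div, inv_pow, ← one_div, le_div_iff₀ (by positivity)]
  have h3 : (‖z‖ * m ^ 2) * (1 + m ^ 2 * r ^ 2) ≤ 1 * (1 + m ^ 2 * r ^ 2) := by
    nlinarith
  exact le_of_mul_le_mul_right h3 (by positivity)

/-- If `a` has real spectrum, the numerator of `z - a² (1 + m² a²)⁻¹` is invertible as soon as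
`‖z‖ > 1 / m²`. -/
theorem isUnit_smul_one_add_sq_sub_sq {A : Type*} [Ring A] [Algebra ℂ A] {a : A}
    (ha : spectrum ℂ a ⊆ Set.range Complex.ofReal) {m : ℝ} (hm : 0 < m) {z : ℂ}
    (hz : (1 / m) ^ 2 < ‖z‖) :
    IsUnit (z • (1 + (m : ℂ) ^ 2 • (a * a)) - a * a) := by
  have hmC : (m : ℂ) ≠ 0 := Complex.ofReal_ne_zero.2 hm.ne'
  have hk : z * (m : ℂ) ^ 2 - 1 ≠ 0 := by
    intro h
    have hz' : z = ((1 / m : ℝ) : ℂ) ^ 2 := by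
      push_cast
      field_simp
      linear_combination h
    rw [hz', norm_pow, Complex.norm_real, Real.norm_of_nonneg (by positivity)] at hz
    exact lt_irrefl _ hz
  obtain ⟨d, hd⟩ := IsAlgClosed.exists_pow_nat_eq (-(z / (z * (m : ℂ) ^ 2 - 1))) (n := 2) (by simp)
  have root : ∀ e : ℂ, e ^ 2 = d ^ 2 → e ∉ spectrum ℂ a := by
    intro e he hmem
    obtain ⟨r, rfl⟩ := ha hmem
    refine hz.not_ge (norm_le_of_mul_one_add_sq_eq_sq (r := r) hm ?_)
    rw [hd] at he
    rw [he]
    field_simp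
    ring
  have h1 := spectrum.notMem_iff.1 (root d rfl)
  have h2 := spectrum.notMem_iff.1 (root (-d) (by ring))
  have hfac : z • (1 + (m : ℂ) ^ 2 • (a * a)) - a * a
      = algebraMap ℂ A (z * (m : ℂ) ^ 2 - 1)
        * ((algebraMap ℂ A d - a) * (algebraMap ℂ A (-d) - a)) := by
    have hprod : (algebraMap ℂ A d - a) * (algebraMap ℂ A (-d) - a)
        = a * a - algebraMap ℂ A (d ^ 2) := by
      rw [map_neg, pow_two, map_mul, sub_mul, mul_sub, mul_sub, mul_neg, mul_neg,
        ← Algebra.commutes d a]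
      abel
    have hcd : (z * (m : ℂ) ^ 2 - 1) * d ^ 2 = -z := by
      rw [hd]
      field_simp
    rw [hprod, mul_sub, ← map_mul, hcd, ← Algebra.smul_def, Algebra.algebraMap_eq_smul_one]
    module
  rw [hfac]
  exact ((isUnit_iff_ne_zero.2 hk).map _).mul (h1.mul h2)

theorem stmt_12 {A : Type*} [NormedRing A] [NormedAlgebra ℂ A] [CompleteSpace A]
    [StarRing A] [StarModule ℂ A]
    (hHerm : ∀ a : A, star a = a → ∀ z ∈ spectrum ℂ a, z.im = 0)
    (a : A) (ha : star a = a)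
    (haspec : spectrum ℂ a ⊆ Complex.ofReal '' Set.Ioi 0) :
    ∀ n : ℕ, 1 ≤ n →
      IsUnit (1 + (Complex.I * (n : ℂ)) • a) ∧
        ptak (a * Ring.inverse (1 + (Complex.I * (n : ℂ)) • a)) ≤ 1 / n := by
  intro n hn
  have hm : (0 : ℝ) < n := by exact_mod_cast hn
  have hreal : spectrum ℂ a ⊆ Set.range Complex.ofReal :=
    haspec.trans (Set.image_subset_range _ _)
  set u : A := 1 + (Complex.I * (n : ℂ)) • a with hu_def
  have hu : IsUnit u := by
    have hc : Complex.I * (n : ℂ) ≠ 0 :=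
      mul_ne_zero Complex.I_ne_zero (by exact_mod_cast hm.ne')
    refine isUnit_one_add_smul_of_neg_inv_notMem hc fun h => ?_
    obtain ⟨r, hr⟩ := hreal h
    have hmul : (r : ℂ) * (Complex.I * (n : ℂ)) = -1 := by
      rw [hr, neg_mul, inv_mul_cancel₀ hc]
    simpa using congrArg Complex.re hmul
  refine ⟨hu, ?_⟩
  set v : A := Ring.inverse u with hv_def
  have huv : u * v = 1 := Ring.mul_inverse_cancel u hu
  have hvu : star v * star u = 1 := by rw [← star_mul, huv, star_one]
  have hv : IsUnit v := hu.ringInverse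
  have huu : star u * u = 1 + (((n : ℝ) : ℂ)) ^ 2 • (a * a) := by
    have hstar : star u = 1 - (Complex.I * (n : ℂ)) • a := by
      simp [hu_def, star_smul, ha, sub_eq_add_neg]
    have hI : (Complex.I * (n : ℂ)) * (Complex.I * (n : ℂ)) = -(((n : ℝ) : ℂ)) ^ 2 := by
      push_cast
      linear_combination (n : ℂ) ^ 2 * Complex.I_mul_I
    rw [hstar, hu_def, sub_mul, mul_add, mul_add, smul_mul_smul_comm, hI, one_mul, one_mul,
      mul_one, neg_smul]
    abel
  have hbound : ∀ z ∈ spectrum ℂ (star (a * v) * (a * v)), ‖z‖ ≤ (1 / (n : ℝ)) ^ 2 := by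
    intro z hz
    by_contra! hlt
    refine hz ?_
    have hconj : algebraMap ℂ A z - star (a * v) * (a * v)
        = star v * (z • (1 + ((n : ℝ) : ℂ) ^ 2 • (a * a)) - a * a) * v := by
      rw [← huu, mul_sub, sub_mul, mul_smul_comm, smul_mul_assoc, ← mul_assoc (star v), hvu,
        one_mul, huv, Algebra.algebraMap_eq_smul_one, star_mul, ha]
      simp only [mul_assoc]
    change IsUnit _
    rw [hconj]
    exact (hv.star.mul (isUnit_smul_one_add_sq_sub_sq hreal hm hlt)).mul hv
  refine Real.sqrt_le_iff.2 ⟨by positivity, ?_⟩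
  refine ENNReal.toReal_le_of_le_ofReal (by positivity) (iSup₂_le fun z hz => ?_)
  rw [← enorm_eq_nnnorm, ← ofReal_norm]
  exact ENNReal.ofReal_le_ofReal (hbound z hz)
end
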